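/- Let S ⊂ P^3 be a reduced surface and assume there exists an irreducible subvariety H ⊂ G(1,3) with dim H ≥ 2 whose general point represents a line in P^3 tangent to S at k > 2 distinct points. Then dim H = 2 and H is a plane in the Plücker embedding, parametrizing the lines contained in a fixed plane M ⊂ P^3 which is tangent to S along a curve. -/

import Mathlib

open MvPolynomial

noncomputable section

namespace PaperLines

variable (K : Type) [Field K]

/-- Projective `N`-space over `K`, as the projectivization of `K^{N+1}`. -/
abbrev PP (N : ℕ) := Projectivization K (Fin (N + 1) → K)

/-- The zero locus in `ℙ^N` of a (homogeneous) polynomial. -/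
def projZeros {N : ℕ} (F : MvPolynomial (Fin (N + 1)) K) : Set (PP K N) :=
  {x | ∀ v ∈ x.submodule, eval v F = 0}

/-- The projective linear subspace associated to a linear subspace `W ⊆ K^{N+1}`. -/
def projLinear {N : ℕ} (W : Submodule K (Fin (N + 1) → K)) : Set (PP K N) :=
  {x | x.submodule ≤ W}

/-- The Grassmannian of `k`-dimensional linear subspaces of `K^{N+1}`
(`k = 2` gives the lines of `ℙ^N`, `k = 3` the planes). -/
def Grass (k N : ℕ) := {W : Submodule K (Fin (N + 1) → K) // Module.finrank K W = k}

/-- The set of lines contained in the hypersurface `{F = 0} ⊆ ℙ^N`. -/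
def fanoSet {N : ℕ} (F : MvPolynomial (Fin (N + 1)) K) : Set (Grass K 2 N) :=
  {W | projLinear K W.1 ⊆ projZeros K F}

/-- `X = {F = 0}` is covered by lines. -/
def CoveredByLines {N : ℕ} (F : MvPolynomial (Fin (N + 1)) K) : Prop :=
  ∀ x ∈ projZeros K F, ∃ W ∈ fanoSet K F, x ∈ projLinear K W.1

/-- The ideal of polynomials vanishing on a subset of affine space `K^σ`. -/
def affVanishing {σ : Type} (S : Set (σ → K)) : Ideal (MvPolynomial σ K) where
  carrier := {f | ∀ v ∈ S, eval v f = 0}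
  add_mem' := by
    intro a b ha hb v hv
    simp only [map_add, ha v hv, hb v hv, add_zero]
  zero_mem' := by intro v hv; simp
  smul_mem' := by
    intro c a ha v hv
    simp only [smul_eq_mul, map_mul, ha v hv, mul_zero]

/-- The dimension of a subset of affine space `K^σ`, as the Krull dimension of its
coordinate ring (this only depends on the Zariski closure). -/
def affDim {σ : Type} (S : Set (σ → K)) : WithBot ℕ∞ :=
  ringKrullDim (MvPolynomial σ K ⧸ affVanishing K S)

/-- The affine cone over a subset of `ℙ^N`. -/
def projCone {N : ℕ} (S : Set (PP K N)) : Set (Fin (N + 1) → K) :=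
  {v | ∃ x ∈ S, v ∈ x.submodule}

/-- A subset of `ℙ^N` has (projective) dimension `d`:  its affine cone has dimension `d+1`. -/
def HasProjDim {N : ℕ} (S : Set (PP K N)) (d : ℕ) : Prop :=
  affDim K (projCone K S) = ((d + 1 : ℕ) : WithBot ℕ∞)

/-- A subset of `ℙ^N` has (projective) dimension at most `d`. -/
def ProjDimLE {N : ℕ} (S : Set (PP K N)) (d : ℕ) : Prop :=
  affDim K (projCone K S) ≤ ((d + 1 : ℕ) : WithBot ℕ∞)

/-- A subset of `ℙ^N` has (projective) dimension at least `d`. -/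
def ProjDimGE {N : ℕ} (S : Set (PP K N)) (d : ℕ) : Prop :=
  ((d + 1 : ℕ) : WithBot ℕ∞) ≤ affDim K (projCone K S)

/-- A `k`-tuple of vectors (a "frame") all lying in the subspace `W`. -/
def frameMem {k N : ℕ} (p : Fin k × Fin (N + 1) → K) (W : Submodule K (Fin (N + 1) → K)) : Prop :=
  ∀ i : Fin k, (fun j => p (i, j)) ∈ W

/-- The "Stiefel cone" over a family of `k`-planes: all `k`-tuples of vectors lying in some
member of the family.  Over a `d`-dimensional family it has dimension `d + k²`. -/
def frameCone (k N : ℕ) (S : Set (Grass K k N)) : Set (Fin k × Fin (N + 1) → K) :=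
  {p | ∃ W ∈ S, frameMem K p W.1}

/-- A family of `k`-planes has dimension `d` (computed via its Stiefel cone). -/
def HasGrDim {k N : ℕ} (S : Set (Grass K k N)) (d : ℕ) : Prop :=
  affDim K (frameCone K k N S) = ((d + k * k : ℕ) : WithBot ℕ∞)

/-- A family of `k`-planes has dimension at least `d`. -/
def GrDimGE {k N : ℕ} (S : Set (Grass K k N)) (d : ℕ) : Prop :=
  ((d + k * k : ℕ) : WithBot ℕ∞) ≤ affDim K (frameCone K k N S)

/-- Zariski-closed subsets of the Grassmannian: common zero sets of families of polynomials
in frame coordinates (vanishing being required for every frame). -/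
def GrClosed {k N : ℕ} (S : Set (Grass K k N)) : Prop :=
  ∃ 𝒢 : Set (MvPolynomial (Fin k × Fin (N + 1)) K),
    S = {W | ∀ G ∈ 𝒢, ∀ p, frameMem K p W.1 → eval p G = 0}

/-- The Zariski closure of a family of `k`-planes in the Grassmannian. -/
def grClosure {k N : ℕ} (S : Set (Grass K k N)) : Set (Grass K k N) :=
  ⋂₀ {C | GrClosed K C ∧ S ⊆ C}

/-- Irreducibility of a family of `k`-planes. -/
def GrIrred {k N : ℕ} (S : Set (Grass K k N)) : Prop :=
  S.Nonempty ∧ ∀ C₁ C₂, GrClosed K C₁ → GrClosed K C₂ → S ⊆ C₁ ∪ C₂ → S ⊆ C₁ ∨ S ⊆ C₂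

/-- `S` is an irreducible component of `T` (a maximal irreducible subset). -/
def IsGrComponentOf {k N : ℕ} (S T : Set (Grass K k N)) : Prop :=
  S ⊆ T ∧ GrIrred K S ∧ ∀ S', S ⊆ S' → S' ⊆ T → GrIrred K S' → S' = S

/-- A property `P` holds for a general member of the family `S` of `k`-planes:
it holds on a nonempty principal open subset of `S`. -/
def GenerallyOnGr {k N : ℕ} (S : Set (Grass K k N)) (P : Grass K k N → Prop) : Prop :=
  ∃ G : MvPolynomial (Fin k × Fin (N + 1)) K,
    (∃ W ∈ S, ∃ p, frameMem K p W.1 ∧ eval p G ≠ 0) ∧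
    ∀ W ∈ S, (∃ p, frameMem K p W.1 ∧ eval p G ≠ 0) → P W

/-- A property `P` holds for a general pair of members of the families `S`, `T`. -/
def GenerallyOnGr2 {k N : ℕ} (S T : Set (Grass K k N))
    (P : Grass K k N → Grass K k N → Prop) : Prop :=
  ∃ G : MvPolynomial ((Fin k × Fin (N + 1)) ⊕ (Fin k × Fin (N + 1))) K,
    (∃ W ∈ S, ∃ W' ∈ T, ∃ p q, frameMem K p W.1 ∧ frameMem K q W'.1 ∧
      eval (Sum.elim p q) G ≠ 0) ∧
    ∀ W ∈ S, ∀ W' ∈ T, (∃ p q, frameMem K p W.1 ∧ frameMem K q W'.1 ∧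
      eval (Sum.elim p q) G ≠ 0) → P W W'

/-- A property `P` holds for a general point of the subset `S ⊆ ℙ^N`. -/
def GenerallyOn {N : ℕ} (S : Set (PP K N)) (P : PP K N → Prop) : Prop :=
  ∃ G : MvPolynomial (Fin (N + 1)) K,
    (∃ x ∈ S, ∃ v ∈ x.submodule, eval v G ≠ 0) ∧
    ∀ x ∈ S, (∃ v ∈ x.submodule, eval v G ≠ 0) → P x

/-- A property `P` holds for a general hyperplane (given by a nonzero linear form `L`). -/
def GenerallyOnHyp {N : ℕ} (P : (Fin (N + 1) → K) → Prop) : Prop :=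
  ∃ G : MvPolynomial (Fin (N + 1)) K,
    (∃ L : Fin (N + 1) → K, L ≠ 0 ∧ eval L G ≠ 0) ∧
    ∀ L : Fin (N + 1) → K, L ≠ 0 → eval L G ≠ 0 → P L

/-- Through a general point of `X = {F = 0}` there pass exactly `μ` lines of the family `Lf`. -/
def HasMuOn {N : ℕ} (Lf : Set (Grass K 2 N)) (F : MvPolynomial (Fin (N + 1)) K)
    (μ : ℕ) : Prop :=
  GenerallyOn K (projZeros K F) (fun x => {W | W ∈ Lf ∧ x ∈ projLinear K W.1}.ncard = μ)

/-- Through a general point of `X = {F = 0}` there pass exactly `μ` lines contained in `X`. -/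
def HasMu {N : ℕ} (F : MvPolynomial (Fin (N + 1)) K) (μ : ℕ) : Prop :=
  HasMuOn K (fanoSet K F) F μ

/-- The ideal of the Fano scheme of lines on `{F = 0}`, in Stiefel (frame) coordinates:
it is generated by the coefficients (in `s,t`) of `F(s·v + t·w)`. -/
def fanoIdeal {N : ℕ} (F : MvPolynomial (Fin (N + 1)) K) :
    Ideal (MvPolynomial (Fin 2 × Fin (N + 1)) K) :=
  Ideal.span {g | ∃ d : Fin 2 →₀ ℕ, g = coeff d
    (aeval (fun j : Fin (N + 1) =>
      (X 0 : MvPolynomial (Fin 2) (MvPolynomial (Fin 2 × Fin (N + 1)) K)) * C (X (0, j)) +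
        X 1 * C (X (1, j))) F)}

/-- An ideal is generically reduced: at every minimal prime `p` over `I`, the localization
of `R/I` is reduced, i.e. `I_p = p_p`. -/
def GenericallyReducedIdeal {R : Type} [CommRing R] (I : Ideal R) : Prop :=
  ∀ p ∈ I.minimalPrimes, ∀ x ∈ p, ∃ s, s ∉ p ∧ s * x ∈ I

/-- The Fano scheme of lines on `{F = 0}` is generically reduced. -/
def FanoGenerallyReduced {N : ℕ} (F : MvPolynomial (Fin (N + 1)) K) : Prop :=
  GenericallyReducedIdeal (fanoIdeal K F)

/-- The prime (in frame coordinates) corresponding to a point `r` of the Grassmannian of lines. -/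
def framePrime {N : ℕ} (r : Grass K 2 N) : Ideal (MvPolynomial (Fin 2 × Fin (N + 1)) K) :=
  affVanishing K (frameCone K 2 N {r})

/-- The Fano scheme of lines on `{F = 0}` is reduced at the line `r`. -/
def FanoReducedAt {N : ℕ} (F : MvPolynomial (Fin (N + 1)) K) (r : Grass K 2 N) : Prop :=
  ∀ x ∈ framePrime K r, ∃ s, s ∉ framePrime K r ∧ s * x ∈ fanoIdeal K F

/-- The Fano scheme is reduced at the generic point of the component `Fam`. -/
def ComponentGenerallyReduced {N : ℕ} (F : MvPolynomial (Fin (N + 1)) K)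
    (Fam : Set (Grass K 2 N)) : Prop :=
  ∀ x ∈ affVanishing K (frameCone K 2 N Fam),
    ∃ s, s ∉ affVanishing K (frameCone K 2 N Fam) ∧ s * x ∈ fanoIdeal K F

/-- The gradient vector of `F` at `v`. -/
def gradVec {N : ℕ} (F : MvPolynomial (Fin (N + 1)) K) (v : Fin (N + 1) → K) :
    Fin (N + 1) → K :=
  fun i => eval v (pderiv i F)

/-- The singular locus of the hypersurface `{F = 0}`. -/
def singLocus {N : ℕ} (F : MvPolynomial (Fin (N + 1)) K) : Set (PP K N) :=
  {x | x ∈ projZeros K F ∧ ∀ v ∈ x.submodule, gradVec K F v = 0}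

/-- `x` is a smooth point of the hypersurface `{F = 0}`. -/
def SmoothAt {N : ℕ} (F : MvPolynomial (Fin (N + 1)) K) (x : PP K N) : Prop :=
  x ∈ projZeros K F ∧ x ∉ singLocus K F

/-- The embedded tangent hyperplane to `{F = 0}` at a (smooth) point `x`. -/
def tangentHyp {N : ℕ} (F : MvPolynomial (Fin (N + 1)) K) (x : PP K N) : Set (PP K N) :=
  {y | ∀ v ∈ x.submodule, ∀ w ∈ y.submodule, ∑ i, gradVec K F v i * w i = 0}

/-- The hyperplane of `ℙ^N` with coefficient vector `L`. -/
def hypSet {N : ℕ} (L : Fin (N + 1) → K) : Set (PP K N) :=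
  {x | ∀ v ∈ x.submodule, ∑ i, L i * v i = 0}

/-- A quadric surface in `ℙ⁴`: a two-dimensional intersection of a quadric and a hyperplane. -/
def IsQuadricSurface (Q : Set (PP K 4)) : Prop :=
  ∃ (q : MvPolynomial (Fin 5) K) (W : Submodule K (Fin 5 → K)),
    q.IsHomogeneous 2 ∧ Module.finrank K W = 4 ∧
    Q = projZeros K q ∩ projLinear K W ∧ HasProjDim K Q 2

/-- `X = {F = 0}` is (birationally) ruled by quadrics over a curve: it is covered by a
one-dimensional family of quadric surfaces with exactly one member through a general point. -/
def QuadricBundle (F : MvPolynomial (Fin 5) K) : Prop :=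
  ∃ 𝒬 : Set (Set (PP K 4)),
    (∀ Q ∈ 𝒬, IsQuadricSurface K Q ∧ Q ⊆ projZeros K F) ∧
    GenerallyOn K (projZeros K F) (fun x => ∃! Q, Q ∈ 𝒬 ∧ x ∈ Q)

/-- The degree of a `d`-dimensional subset `S ⊆ ℙ^N`: the largest finite number of points in
which a linear subspace of complementary dimension meets `S`. -/
def projDegree {N : ℕ} (S : Set (PP K N)) (d : ℕ) : ℕ :=
  sSup {m | ∃ W : Submodule K (Fin (N + 1) → K), Module.finrank K W = N + 1 - d ∧
    (S ∩ projLinear K W).Finite ∧ (S ∩ projLinear K W).ncard = m}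

/-- Zariski-closed subsets of `ℙ^N`. -/
def ProjClosed {N : ℕ} (S : Set (PP K N)) : Prop :=
  ∃ 𝒮 : Set (MvPolynomial (Fin (N + 1)) K),
    S = {x | ∀ f ∈ 𝒮, ∀ v ∈ x.submodule, eval v f = 0}

/-- The Zariski closure of a subset of `ℙ^N`. -/
def projClosure {N : ℕ} (S : Set (PP K N)) : Set (PP K N) :=
  ⋂₀ {C | ProjClosed K C ∧ S ⊆ C}

/-- The image of a subset of `ℙ^a` under the rational map `ℙ^a ⤏ ℙ^b` induced by a
linear map `T : K^{a+1} → K^{b+1}`. -/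
def projImage {a b : ℕ} (T : (Fin (a + 1) → K) →ₗ[K] (Fin (b + 1) → K))
    (Y : Set (PP K a)) : Set (PP K b) :=
  {x | ∃ y ∈ Y, ∃ v ∈ y.submodule, ∃ h : T v ≠ 0, x = Projectivization.mk K (T v) h}

/-- `Xs ⊆ ℙ^b` is a (linear) projection of `Y ⊆ ℙ^a`. -/
def IsProjectionOf {a b : ℕ} (Xs : Set (PP K b)) (Y : Set (PP K a)) : Prop :=
  ∃ T : (Fin (a + 1) → K) →ₗ[K] (Fin (b + 1) → K),
    Xs = projClosure K (projImage K T Y)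

/-- `Y ⊆ ℙ⁵` is a three-dimensional complete intersection of two quadric hypersurfaces. -/
def IsQuadricIntersection5 (Y : Set (PP K 5)) : Prop :=
  ∃ q₁ q₂ : MvPolynomial (Fin 6) K, q₁.IsHomogeneous 2 ∧ q₂.IsHomogeneous 2 ∧
    Y = projZeros K q₁ ∩ projZeros K q₂ ∧ HasProjDim K Y 3

def idx55 : Fin 25 ≃ Fin 5 × Fin 5 :=
  (finCongr (by norm_num : 25 = 5 * 5)).trans finProdFinEquiv.symm

/-- The Plücker coordinate vector of the pair `(v, w)`. -/
def pluckOf (v w : Fin 5 → K) : Fin 25 → K :=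
  fun kk => v (idx55 kk).1 * w (idx55 kk).2 - v (idx55 kk).2 * w (idx55 kk).1

/-- The Grassmannian `G(1,4)` of lines of `ℙ⁴` in its Plücker embedding. -/
def grassPlucker : Set (PP K 24) :=
  {x | ∃ v w : Fin 5 → K, ∃ h : pluckOf K v w ≠ 0,
    x = Projectivization.mk K (pluckOf K v w) h}

/-- `Y` is a section of the Plücker-embedded `G(1,4)` by a linear `ℙ⁶`. -/
def IsGrassP6Section (Y : Set (PP K 24)) : Prop :=
  ∃ W : Submodule K (Fin 25 → K), Module.finrank K W = 7 ∧
    Y = grassPlucker K ∩ projLinear K W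

def idx33 : Fin 9 ≃ Fin 3 × Fin 3 :=
  (finCongr (by norm_num : 9 = 3 * 3)).trans finProdFinEquiv.symm

def segre22Vec (a b : Fin 3 → K) : Fin 9 → K := fun kk => a (idx33 kk).1 * b (idx33 kk).2

/-- The Segre embedding of `ℙ² × ℙ²` in `ℙ⁸`. -/
def segreP2P2 : Set (PP K 8) :=
  {x | ∃ a b : Fin 3 → K, ∃ h : segre22Vec K a b ≠ 0,
    x = Projectivization.mk K (segre22Vec K a b) h}

def idx222 : Fin 8 ≃ Fin 2 × Fin 2 × Fin 2 :=
  (finCongr (by norm_num : 8 = 2 * 4)).trans (finProdFinEquiv.symm.trans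
    (Equiv.prodCongr (Equiv.refl _)
      ((finCongr (by norm_num : 4 = 2 * 2)).trans finProdFinEquiv.symm)))

def segre111Vec (a b c : Fin 2 → K) : Fin 8 → K :=
  fun kk => a (idx222 kk).1 * b (idx222 kk).2.1 * c (idx222 kk).2.2

/-- The Segre embedding of `ℙ¹ × ℙ¹ × ℙ¹` in `ℙ⁷`. -/
def segreP1P1P1 : Set (PP K 7) :=
  {x | ∃ a b c : Fin 2 → K, ∃ h : segre111Vec K a b c ≠ 0,
    x = Projectivization.mk K (segre111Vec K a b c) h}

def evalVec {m l : ℕ} (f : Fin l → MvPolynomial (Fin m) K) (v : Fin m → K) : Fin l → K :=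
  fun j => eval v (f j)

/-- Two projective sets are birational: there are rational maps, given by homogeneous
polynomials, defined and mutually inverse on general points. -/
def AreBirational {a b : ℕ} (C : Set (PP K a)) (D : Set (PP K b)) : Prop :=
  ∃ (f : Fin (b + 1) → MvPolynomial (Fin (a + 1)) K)
    (g : Fin (a + 1) → MvPolynomial (Fin (b + 1)) K) (d e : ℕ),
    (∀ j, (f j).IsHomogeneous d) ∧ (∀ i, (g i).IsHomogeneous e) ∧
    GenerallyOn K C (fun x => ∃ v ∈ x.submodule, ∃ h : evalVec K f v ≠ 0,
      Projectivization.mk K (evalVec K f v) h ∈ D ∧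
      ∃ h2 : evalVec K g (evalVec K f v) ≠ 0,
        Projectivization.mk K (evalVec K g (evalVec K f v)) h2 = x) ∧
    GenerallyOn K D (fun y => ∃ w ∈ y.submodule, ∃ h : evalVec K g w ≠ 0,
      Projectivization.mk K (evalVec K g w) h ∈ C ∧
      ∃ h2 : evalVec K f (evalVec K g w) ≠ 0,
        Projectivization.mk K (evalVec K f (evalVec K g w)) h2 = y)

/-- A smooth plane cubic curve (its equation). -/
def IsSmoothPlaneCubic (q : MvPolynomial (Fin 3) K) : Prop :=
  q.IsHomogeneous 3 ∧
    ∀ v : Fin 3 → K, v ≠ 0 → eval v q = 0 → (fun i => eval v (pderiv i q)) ≠ 0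

/-- The hypersurface `{F = 0} ⊆ ℙ⁴` has sectional genus one: its general plane section is a
curve birational to a smooth plane cubic (i.e. of geometric genus `1`). -/
def SectionalGenusOne (F : MvPolynomial (Fin 5) K) : Prop :=
  GenerallyOnGr K (Set.univ : Set (Grass K 3 4)) (fun P =>
    ∃ q : MvPolynomial (Fin 3) K, IsSmoothPlaneCubic K q ∧
      AreBirational K (projZeros K F ∩ projLinear K P.1) (projZeros (N := 2) K q))

/-- The length of a module, as the Krull dimension of its lattice of submodules. -/
def moduleLength (R M : Type) [CommRing R] [AddCommGroup M] [Module R M] : WithBot ℕ∞ :=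
  Order.krullDim (Submodule R M)

/-- The length of the localization of `R/I` at (the complement of) `p`:  when `p` is a prime
containing `I` this is the intersection multiplicity of the scheme `V(I)` at `p`. -/
def localLength {R : Type} [CommRing R] (I p : Ideal R) : WithBot ℕ∞ :=
  moduleLength (Localization (Submonoid.closure {s : R | s ∉ p}))
    (LocalizedModule (Submonoid.closure {s : R | s ∉ p}) (R ⧸ I))

/-- The frame-coordinate ideal of the Schubert variety of lines contained in the hyperplane
with coefficient vector `L`. -/
def hypFrameIdeal (L : Fin 5 → K) : Ideal (MvPolynomial (Fin 2 × Fin 5) K) :=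
  Ideal.span {∑ j, C (L j) * X ((0 : Fin 2), j), ∑ j, C (L j) * X ((1 : Fin 2), j)}

/-- The restriction of a polynomial to the line spanned by `v` and `w`, as a binary form in
the parameters. -/
def restrictLine {N : ℕ} (v w : Fin (N + 1) → K) (G : MvPolynomial (Fin (N + 1)) K) :
    MvPolynomial (Fin 2) K :=
  aeval (fun j => C (v j) * X 0 + C (w j) * X 1) G

/-- The homogeneous polynomials vanishing on a subset `S ⊆ ℙ^N`. -/
def homVanishing {N : ℕ} (S : Set (PP K N)) : Set (MvPolynomial (Fin (N + 1)) K) :=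
  {f | ∀ x ∈ S, ∀ v ∈ x.submodule, eval v f = 0}

/-- The embedded (projectivized) tangent space to the subset `S ⊆ ℙ^N` at the point `P`. -/
def projTangentAt {N : ℕ} (S : Set (PP K N)) (P : PP K N) : Set (PP K N) :=
  {y | ∀ f ∈ homVanishing K S, ∀ v ∈ P.submodule, ∀ w ∈ y.submodule,
    ∑ i, eval v (pderiv i f) * w i = 0}

/-- `P` is a smooth point of the surface `S`: its embedded tangent space is a plane. -/
def IsSmoothSurfacePoint {N : ℕ} (S : Set (PP K N)) (P : PP K N) : Prop :=
  P ∈ S ∧ ∃ W : Submodule K (Fin (N + 1) → K), Module.finrank K W = 3 ∧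
    projTangentAt K S P = projLinear K W

/-- The line `L` is tangent to the surface `S` at the smooth point `P`. -/
def IsTangentLineAt {N : ℕ} (S : Set (PP K N)) (L : Grass K 2 N) (P : PP K N) : Prop :=
  IsSmoothSurfacePoint K S P ∧ P ∈ projLinear K L.1 ∧
    projLinear K L.1 ⊆ projTangentAt K S P

/-- The surface `σ(r)`: the union of the lines of the Fano family meeting the line `r`. -/
def sigmaSurf (F : MvPolynomial (Fin 5) K) (r : Grass K 2 4) : Set (PP K 4) :=
  {x | ∃ W ∈ fanoSet K F, (projLinear K W.1 ∩ projLinear K r.1).Nonempty ∧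
    x ∈ projLinear K W.1}

/-- Substitution of a linear endomorphism into a polynomial: `linSubst φ P = P ∘ φ`. -/
def linSubst {m : ℕ} (φ : (Fin m → K) →ₗ[K] (Fin m → K)) (P : MvPolynomial (Fin m) K) :
    MvPolynomial (Fin m) K :=
  aeval (fun i => ∑ j, C (φ (Pi.single j 1) i) * X j) P

/-- Dehomogenization with respect to the coordinate `x₀`. -/
def dehomAt0 {m : ℕ} (P : MvPolynomial (Fin (m + 1)) K) : MvPolynomial (Fin m) K :=
  aeval (fun i : Fin (m + 1) => Fin.cases 1 (fun j => X j) i) P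

/-- The Gauss image (dual variety, up to closure) of the hypersurface `{F = 0} ⊆ ℙ^N`. -/
def dualVariety {N : ℕ} (F : MvPolynomial (Fin (N + 1)) K) : Set (PP K N) :=
  {h | ∃ x, SmoothAt K F x ∧ ∃ v ∈ x.submodule, ∃ hnz : gradVec K F v ≠ 0,
    h = Projectivization.mk K (gradVec K F v) hnz}

end PaperLines

namespace PaperLines

open Matrix


open scoped IntermediateField.algebraAdjoinAdjoin in
theorem exists_derivation_of_algebraicIndependent {K E ι : Type*} [Field K] [Field E] [Algebra K E]
    [CharZero K] {y : ι → E} (hy : AlgebraicIndependent K y) (c : ι → E) :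
    ∃ D : Derivation K E E, ∀ i, D (y i) = c i := by
  classical
  obtain ⟨s, hys, hs⟩ := exists_isTranscendenceBasis_superset hy.coe_range
  let b : s → E := (↑)
  have hb : AlgebraicIndependent K b := hs.1
  let : Algebra (MvPolynomial s K) E := (aeval (R := K) b).toAlgebra
  have hmap : ∀ p, algebraMap (MvPolynomial s K) E p = aeval b p := fun _ => rfl
  have : IsScalarTower K (MvPolynomial s K) E := IsScalarTower.of_algHom (aeval b)
  let : Algebra (MvPolynomial s K) (Algebra.adjoin K (Set.range b)) :=
    hb.aevalEquiv.toAlgHom.toAlgebra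
  have : IsScalarTower (MvPolynomial s K) (Algebra.adjoin K (Set.range b)) E :=
    IsScalarTower.of_algebraMap_eq fun p => (hb.algebraMap_aevalEquiv p).symm
  have e1 : Algebra.FormallyEtale (MvPolynomial s K) (Algebra.adjoin K (Set.range b)) :=
    .of_equiv (AlgEquiv.ofRingEquiv (f := hb.aevalEquiv.toRingEquiv) fun _ => rfl)
  have e2 : Algebra.FormallyEtale (Algebra.adjoin K (Set.range b))
      (IntermediateField.adjoin K (Set.range b)) := .of_isLocalization (nonZeroDivisors _)
  have : Algebra.IsAlgebraic (IntermediateField.adjoin K (Set.range b)) E := hs.isAlgebraic_field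
  have e3 : Algebra.FormallyEtale (IntermediateField.adjoin K (Set.range b)) E :=
    Algebra.FormallyEtale.of_isSeparable _ E
  have e4 : Algebra.FormallyEtale (Algebra.adjoin K (Set.range b)) E :=
    .comp _ (IntermediateField.adjoin K (Set.range b)) _
  have e5 : Algebra.FormallyEtale (MvPolynomial s K) E :=
    .comp _ (Algebra.adjoin K (Set.range b)) _
  let d : Derivation K (MvPolynomial s K) E := mkDerivation K fun x => Function.extend y c 0 x
  let φ := (d.liftKaehlerDifferential.liftBaseChange E) ∘ₗ
    (KaehlerDifferential.tensorKaehlerEquivOfFormallyEtale K (MvPolynomial s K) E).symm.toLinearMap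
  refine ⟨φ.compDer (KaehlerDifferential.D K E), fun i => ?_⟩
  have hyi : y i = algebraMap (MvPolynomial s K) E (X ⟨y i, hys ⟨i, rfl⟩⟩) := by
    rw [hmap, aeval_X]
  change φ (KaehlerDifferential.D K E (y i)) = _
  conv_lhs => rw [hyi]
  simp only [φ, LinearMap.comp_apply, LinearEquiv.coe_coe,
    KaehlerDifferential.tensorKaehlerEquivOfFormallyEtale_symm_D_algebraMap]
  simp [d, mkDerivation_X, hy.injective.extend_apply]

theorem ringKrullDim_le_of_isIntegral {A B : Type*} [CommRing A] [CommRing B] [Algebra A B]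
    [Algebra.IsIntegral A B] : ringKrullDim B ≤ ringKrullDim A := by
  refine Order.krullDim_le_of_strictMono (PrimeSpectrum.comap (algebraMap A B)) fun p q hpq => ?_
  exact Ideal.IsIntegral.comap_lt_comap (I := p.asIdeal) (J := q.asIdeal) hpq

/-- A chain of primes lifts along an injective integral extension; chains of length two suffice
here. -/
theorem two_le_ringKrullDim_of_isIntegral {A B : Type*} [CommRing A] [CommRing B] [Algebra A B]
    [Algebra.IsIntegral A B] (hinj : Function.Injective (algebraMap A B))
    (h : 2 ≤ ringKrullDim A) : 2 ≤ ringKrullDim B := by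
  have h' : ((2 : ℕ) : WithBot ℕ∞) ≤ Order.krullDim (PrimeSpectrum A) := h
  rw [Order.le_krullDim_iff] at h'
  obtain ⟨l, hl⟩ := h'
  have h01 : l ⟨0, by omega⟩ < l ⟨1, by omega⟩ := l.strictMono (by simp [Fin.lt_def])
  have h12 : l ⟨1, by omega⟩ < l ⟨2, by omega⟩ := l.strictMono (by simp [Fin.lt_def])
  obtain ⟨Q0, -, hQ0, hc0⟩ := Ideal.exists_ideal_over_prime_of_isIntegral
    (l ⟨0, by omega⟩).asIdeal (⊥ : Ideal B)
    (by rw [← RingHom.ker_eq_comap_bot, (RingHom.injective_iff_ker_eq_bot _).1 hinj]; exact bot_le)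
  obtain ⟨Q1, hle1, hQ1, hc1⟩ := Ideal.exists_ideal_over_prime_of_isIntegral
    (l ⟨1, by omega⟩).asIdeal Q0 (by rw [hc0]; exact h01.le)
  obtain ⟨Q2, hle2, hQ2, hc2⟩ := Ideal.exists_ideal_over_prime_of_isIntegral
    (l ⟨2, by omega⟩).asIdeal Q1 (by rw [hc1]; exact h12.le)
  have n1 : Q0 < Q1 := lt_of_le_of_ne hle1 fun e => by
    apply h01.ne; ext1; rw [← hc0, ← hc1, e]
  have n2 : Q1 < Q2 := lt_of_le_of_ne hle2 fun e => by
    apply h12.ne; ext1; rw [← hc1, ← hc2, e]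
  change ((2 : ℕ) : WithBot ℕ∞) ≤ Order.krullDim (PrimeSpectrum B)
  rw [Order.le_krullDim_iff]
  refine ⟨⟨2, ![⟨Q0, hQ0⟩, ⟨Q1, hQ1⟩, ⟨Q2, hQ2⟩], fun i => ?_⟩, rfl⟩
  fin_cases i
  exacts [n1, n2]

theorem exists_algebraicIndependent_of_le_ringKrullDim (K A : Type*) [Field K] [CommRing A]
    [Nontrivial A] [Algebra K A] [Algebra.FiniteType K A] (n : ℕ)
    (h : (n : WithBot ℕ∞) ≤ ringKrullDim A) :
    ∃ y : Fin n → A, AlgebraicIndependent K y := by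
  obtain ⟨s, g, hg, hgi⟩ := exists_integral_inj_algHom_of_fg K A
  let := g.toRingHom.toAlgebra
  have : Algebra.IsIntegral (MvPolynomial (Fin s) K) A := ⟨hgi⟩
  have h1 := h.trans (ringKrullDim_le_of_isIntegral (A := MvPolynomial (Fin s) K) (B := A))
  rw [MvPolynomial.ringKrullDim_of_isNoetherianRing, ringKrullDim_eq_zero_of_field, zero_add,
    Nat.card_fin] at h1
  have hns : n ≤ s := by exact_mod_cast h1
  refine ⟨fun i => g (X (Fin.castLE hns i)), ?_⟩
  have := ((algebraicIndependent_X (Fin s) K).map' hg).comp _ (Fin.castLE_injective hns)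
  exact this

theorem two_le_ringKrullDim_of_algebraicIndependent (K A : Type) [Field K] [CommRing A]
    [IsDomain A] [Algebra K A] [Algebra.FiniteType K A] (y : Fin 2 → A)
    (hy : AlgebraicIndependent K y) : 2 ≤ ringKrullDim A := by
  obtain ⟨s, g, hg, hgi⟩ := exists_integral_inj_algHom_of_fg K A
  have hx := (algebraicIndependent_X (Fin s) K).map' hg
  let := g.toRingHom.toAlgebra
  have : Algebra.IsIntegral (MvPolynomial (Fin s) K) A := ⟨hgi⟩
  have : IsScalarTower K (MvPolynomial (Fin s) K) A := IsScalarTower.of_algHom g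
  have : FaithfulSMul (MvPolynomial (Fin s) K) A :=
    (faithfulSMul_iff_algebraMap_injective _ _).2 hg
  have htr : Algebra.trdeg K A = s := by
    rw [← trdeg_add_eq K (MvPolynomial (Fin s) K) (A := A),
      trdeg_eq_zero (R := MvPolynomial (Fin s) K)]
    simp
  have h2 : (2 : ℕ) ≤ s := by
    have := hy.cardinalMk_le_trdeg
    rw [htr] at this
    simpa using this
  refine two_le_ringKrullDim_of_isIntegral (A := MvPolynomial (Fin s) K) hg ?_
  rw [MvPolynomial.ringKrullDim_of_isNoetherianRing, ringKrullDim_eq_zero_of_field, zero_add,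
    Nat.card_fin]
  exact_mod_cast h2

section
variable {K E : Type*} [Field K] [Field E] [Algebra K E]

theorem derivation_dotProduct {n : ℕ} (D : Derivation K E E) (a b : Fin n → E) :
    D (a ⬝ᵥ b) = (fun i => D (a i)) ⬝ᵥ b + a ⬝ᵥ fun i => D (b i) := by
  simp only [dotProduct, map_sum, Derivation.leibniz, smul_eq_mul, ← Finset.sum_add_distrib]
  exact Finset.sum_congr rfl fun i _ => by ring

theorem finrank_orthogonal_pair {v w : Fin 4 → E} (h : LinearIndependent E ![v, w]) :
    Module.finrank E (LinearMap.ker (Matrix.of ![v, w]).mulVecLin) = 2 := by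
  have h1 := LinearMap.finrank_range_add_finrank_ker (Matrix.of ![v, w]).mulVecLin
  have h2 : (Matrix.of ![v, w]).rank = 2 := by
    simpa using LinearIndependent.rank_matrix (M := Matrix.of ![v, w]) h
  rw [Matrix.rank] at h2
  simp only [Module.finrank_fin_fun] at h1
  omega

theorem mem_ker_pair_iff {v w u : Fin 4 → E} :
    u ∈ LinearMap.ker (Matrix.of ![v, w]).mulVecLin ↔ u ⬝ᵥ v = 0 ∧ u ⬝ᵥ w = 0 := by
  rw [LinearMap.mem_ker, Matrix.mulVecLin_apply, funext_iff, Fin.forall_fin_two]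
  simp [Matrix.mulVec, dotProduct_comm u]

theorem exists_orthogonal_not_smul {v w : Fin 4 → E} (h : LinearIndependent E ![v, w])
    (m : Fin 4 → E) :
    ∃ n : Fin 4 → E, n ⬝ᵥ v = 0 ∧ n ⬝ᵥ w = 0 ∧ ∀ c : E, n ≠ c • m := by
  by_contra! hcon
  have hle : LinearMap.ker (Matrix.of ![v, w]).mulVecLin ≤ Submodule.span E {m} := fun u hu => by
    obtain ⟨c, hc⟩ := hcon u (mem_ker_pair_iff.1 hu).1 (mem_ker_pair_iff.1 hu).2
    exact Submodule.mem_span_singleton.2 ⟨c, hc.symm⟩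
  have h1 := Submodule.finrank_mono hle
  rw [finrank_orthogonal_pair h] at h1
  have := finrank_span_le_card (R := E) ({m} : Set (Fin 4 → E))
  simp at this
  omega

theorem exists_eq_smul_add_smul_of_orthogonal {v w m n u : Fin 4 → E}
    (h : LinearIndependent E ![v, w]) (hmn : LinearIndependent E ![m, n])
    (hmv : m ⬝ᵥ v = 0) (hmw : m ⬝ᵥ w = 0) (hnv : n ⬝ᵥ v = 0) (hnw : n ⬝ᵥ w = 0)
    (huv : u ⬝ᵥ v = 0) (huw : u ⬝ᵥ w = 0) : ∃ a b : E, u = a • m + b • n := by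
  have hle : Submodule.span E {m, n} ≤ LinearMap.ker (Matrix.of ![v, w]).mulVecLin := by
    rw [Submodule.span_le]
    rintro x (rfl | rfl)
    exacts [mem_ker_pair_iff.2 ⟨hmv, hmw⟩, mem_ker_pair_iff.2 ⟨hnv, hnw⟩]
  have heq := Submodule.eq_of_le_of_finrank_eq hle (by
    rw [finrank_orthogonal_pair h]
    have := finrank_span_eq_card hmn
    rwa [Matrix.range_cons_cons_empty, Fintype.card_fin] at this)
  have hu := mem_ker_pair_iff.2 ⟨huv, huw⟩
  rw [← heq, Submodule.mem_span_pair] at hu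
  obtain ⟨a, b, hab⟩ := hu
  exact ⟨a, b, hab.symm⟩

/-- The differentials of the coordinates of the pair `(v, w)` satisfy at most two linear
relations. -/
def AtMostTwoRelations (K : Type*) {E : Type*} [Field K] [Field E] [Algebra K E]
    (v w : Fin 4 → E) : Prop :=
  ∀ α β : Fin 3 → Fin 4 → E,
    (∀ k, ∀ D : Derivation K E E,
      α k ⬝ᵥ (fun i => D (v i)) + β k ⬝ᵥ (fun i => D (w i)) = 0) →
    ∃ c : Fin 3 → E, c ≠ 0 ∧ ∑ k, c k • α k = 0 ∧ ∑ k, c k • β k = 0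

theorem AtMostTwoRelations.eq_zero_of_pair {v w m n : Fin 4 → E} (hvw : AtMostTwoRelations K v w)
    (hmn : LinearIndependent E ![m, n])
    (hmv : ∀ D : Derivation K E E, m ⬝ᵥ (fun i => D (v i)) = 0)
    (hmw : ∀ D : Derivation K E E, m ⬝ᵥ (fun i => D (w i)) = 0) {ξ η : E}
    (hn : ∀ D : Derivation K E E,
      ξ * (n ⬝ᵥ (fun i => D (v i))) + η * (n ⬝ᵥ (fun i => D (w i))) = 0) :
    ξ = 0 ∧ η = 0 := by
  obtain ⟨c, hc0, h1, h2⟩ := hvw ![m, 0, ξ • n] ![0, m, η • n] (fun k D => by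
    fin_cases k
    · simpa using hmv D
    · simpa using hmw D
    · simpa [smul_dotProduct] using hn D)
  rw [LinearIndependent.pair_iff] at hmn
  simp only [Fin.sum_univ_three] at h1 h2
  simp [smul_smul] at h1 h2
  have e1 := hmn _ _ h1
  have e2 := hmn _ _ h2
  by_cases h : c 2 = 0
  · exfalso
    apply hc0
    funext k
    fin_cases k
    exacts [e1.1, e2.1, h]
  · simpa [h] using And.intro e1.2 e2.2

theorem mem_range_algebraMap_of_isAlgebraic [IsAlgClosed K] {z : E} (hz : IsAlgebraic K z) :
    ∃ a : K, algebraMap K E a = z :=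
  minpoly.mem_range_of_degree_eq_one K z
    (IsAlgClosed.degree_eq_one_of_irreducible K (minpoly.irreducible hz.isIntegral))

theorem mem_range_algebraMap_of_forall_derivation [IsAlgClosed K]
    (hex : ∀ z : E, Transcendental K z → ∃ D : Derivation K E E, D z ≠ 0) {z : E}
    (hz : ∀ D : Derivation K E E, D z = 0) : ∃ a : K, algebraMap K E a = z := by
  by_cases h : IsAlgebraic K z
  · exact mem_range_algebraMap_of_isAlgebraic h
  · obtain ⟨D, hD⟩ := hex z h
    exact absurd (hz D) hD

theorem eq_smul_or_pair {m n : Fin 4 → E} (hm : m ≠ 0) (h : ¬ LinearIndependent E ![m, n]) :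
    ∃ c : E, n = c • m := by
  rw [LinearIndependent.pair_iff' hm] at h
  push Not at h
  obtain ⟨a, ha⟩ := h
  exact ⟨a, ha.symm⟩

theorem dotProduct_derivation_point {v w m : Fin 4 → E} (hmv : m ⬝ᵥ v = 0) (hmw : m ⬝ᵥ w = 0)
    (s t : E) (D : Derivation K E E) :
    m ⬝ᵥ (fun i => D ((s • v + t • w) i)) =
      s * (m ⬝ᵥ fun i => D (v i)) + t * (m ⬝ᵥ fun i => D (w i)) := by
  have : (fun i => D ((s • v + t • w) i)) =
      s • (fun i => D (v i)) + D s • v + (t • (fun i => D (w i)) + D t • w) := by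
    funext i
    simp only [Pi.add_apply, Pi.smul_apply, smul_eq_mul, map_add, Derivation.leibniz]
    ring
  rw [this]
  simp [dotProduct_add, dotProduct_smul, hmv, hmw]

/-- A hyperplane field that is constant along two points moving on the line `⟨v, w⟩` is
constant. -/
theorem AtMostTwoRelations.derivation_eq_zero {v w m : Fin 4 → E} (hvw : AtMostTwoRelations K v w)
    (hli : LinearIndependent E ![v, w]) {j : Fin 4} (hj : m j = 1)
    (hmv : m ⬝ᵥ v = 0) (hmw : m ⬝ᵥ w = 0)
    (hmdv : ∀ D : Derivation K E E, m ⬝ᵥ (fun i => D (v i)) = 0)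
    (hmdw : ∀ D : Derivation K E E, m ⬝ᵥ (fun i => D (w i)) = 0)
    (D' : Derivation K E E) : (fun i => D' (m i)) = 0 := by
  by_contra hn0
  set n : Fin 4 → E := fun i => D' (m i) with hn
  have hdv : ∀ D : Derivation K E E, (fun i => D (m i)) ⬝ᵥ v = 0 := fun D => by
    have := derivation_dotProduct D m v
    rw [hmv, map_zero, hmdv, add_zero] at this
    exact this.symm
  have hdw : ∀ D : Derivation K E E, (fun i => D (m i)) ⬝ᵥ w = 0 := fun D => by
    have := derivation_dotProduct D m w
    rw [hmw, map_zero, hmdw, add_zero] at this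
    exact this.symm
  have hnj : n j = 0 := by simp [hn, hj]
  have hmn : LinearIndependent E ![m, n] := by
    by_contra h
    obtain ⟨c, hc⟩ := eq_smul_or_pair (fun h0 => by simp [h0] at hj) h
    have : c = 0 := by simpa [hnj, hj] using (congr_fun hc j).symm
    exact hn0 (by rw [hc, this, zero_smul])
  have hD : ∀ D : Derivation K E E, ∃ c : E, ∀ i, D (m i) = c * n i := fun D => by
    obtain ⟨a, c, hac⟩ := exists_eq_smul_add_smul_of_orthogonal hli hmn hmv hmw (hdv D') (hdw D')
      (hdv D) (hdw D)
    have ha : a = 0 := by simpa [hj, hnj] using (congr_fun hac j).symm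
    exact ⟨c, fun i => by simpa [ha] using congr_fun hac i⟩
  have key : ∀ D : Derivation K E E, ∃ c : E, ∀ u : Fin 4 → E, n ⬝ᵥ u = 0 →
      n ⬝ᵥ (fun i => D (u i)) = c * (n ⬝ᵥ fun i => D' (u i)) := fun D => by
    obtain ⟨c, hc⟩ := hD D
    let D₁ : Derivation K E E := D - c • D'
    have hD₁m : ∀ i, D₁ (m i) = 0 := fun i => by simp [D₁, hc, hn]
    obtain ⟨c', hc'⟩ := hD ⁅D₁, D'⁆
    have hD₁n : (fun i => D₁ (n i)) = c' • n := by
      funext i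
      have := hc' i
      rw [Derivation.commutator_apply, hD₁m, map_zero, sub_zero] at this
      exact this
    refine ⟨c, fun u hu => ?_⟩
    have h1 := derivation_dotProduct D₁ n u
    rw [hu, map_zero, hD₁n, smul_dotProduct, hu, smul_zero, zero_add] at h1
    have h2 : (fun i => D₁ (u i)) = (fun i => D (u i)) - c • fun i => D' (u i) := by
      funext i
      simp [D₁]
    rw [h2, dotProduct_sub, dotProduct_smul, smul_eq_mul] at h1
    exact (sub_eq_zero.1 h1.symm)
  set a := n ⬝ᵥ fun i => D' (v i)
  set b := n ⬝ᵥ fun i => D' (w i)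
  have hrel : ∀ D : Derivation K E E, ∃ c : E, n ⬝ᵥ (fun i => D (v i)) = c * a ∧
      n ⬝ᵥ (fun i => D (w i)) = c * b := fun D => by
    obtain ⟨c, hc⟩ := key D
    exact ⟨c, hc v (hdv D'), hc w (hdw D')⟩
  have h1 := hvw.eq_zero_of_pair hmn hmdv hmdw (ξ := b) (η := -a) fun D => by
    obtain ⟨c, h1, h2⟩ := hrel D
    rw [h1, h2]
    ring
  have h2 := hvw.eq_zero_of_pair hmn hmdv hmdw (ξ := 1) (η := 0) fun D => by
    obtain ⟨c, h1', h2'⟩ := hrel D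
    rw [h1', neg_eq_zero.1 h1.2]
    ring
  exact one_ne_zero h2.1

theorem AtMostTwoRelations.exists_eq_smul {v w : Fin 4 → E} (hvw : AtMostTwoRelations K v w)
    {s t : Fin 3 → E} (hst : ∀ i j, i ≠ j → s i * t j - s j * t i ≠ 0) {m : Fin 3 → Fin 4 → E}
    (hm : ∀ k, m k ≠ 0) (hmv : ∀ k, m k ⬝ᵥ v = 0) (hmw : ∀ k, m k ⬝ᵥ w = 0)
    (hmd : ∀ k, ∀ D : Derivation K E E,
      m k ⬝ᵥ (fun i => D ((s k • v + t k • w) i)) = 0) :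
    ∃ c : E, m 1 = c • m 0 := by
  refine eq_smul_or_pair (hm 0) fun hli => ?_
  obtain ⟨c, hc0, h1, h2⟩ := hvw (fun k => s k • m k) (fun k => t k • m k) fun k D => by
    rw [smul_dotProduct, smul_dotProduct, smul_eq_mul, smul_eq_mul,
      ← dotProduct_derivation_point (hmv k) (hmw k), hmd]
  simp only [Fin.sum_univ_three, smul_smul] at h1 h2
  rw [LinearIndependent.pair_iff] at hli
  have h3 := hli (c 0 * (s 0 * t 2 - s 2 * t 0)) (c 1 * (s 1 * t 2 - s 2 * t 1)) (by
    funext i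
    have h1 := congr_fun h1 i
    have h2 := congr_fun h2 i
    simp only [Pi.add_apply, Pi.smul_apply, smul_eq_mul, Pi.zero_apply] at h1 h2 ⊢
    linear_combination t 2 * h1 - s 2 * h2)
  have c0 : c 0 = 0 := (mul_eq_zero.1 h3.1).resolve_right (hst 0 2 (by decide))
  have c1 : c 1 = 0 := (mul_eq_zero.1 h3.2).resolve_right (hst 1 2 (by decide))
  have c2 : c 2 ≠ 0 := fun c2 => hc0 (by funext k; fin_cases k; exacts [c0, c1, c2])
  simp only [c0, c1, zero_mul, zero_smul, zero_add, smul_eq_zero, hm 2, or_false, mul_eq_zero,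
    c2, false_or] at h1 h2
  exact hst 0 2 (by decide) (by simp [h1, h2])

theorem AtMostTwoRelations.exists_transcendental_ratio [IsAlgClosed K] {v w m : Fin 4 → E}
    (hvw : AtMostTwoRelations K v w) (hli : LinearIndependent E ![v, w]) (hm : m ≠ 0)
    (hmdv : ∀ D : Derivation K E E, m ⬝ᵥ (fun i => D (v i)) = 0)
    (hmdw : ∀ D : Derivation K E E, m ⬝ᵥ (fun i => D (w i)) = 0)
    {s t : E} (hst : s ≠ 0 ∨ t ≠ 0) :
    ∃ i j, (s • v + t • w) j ≠ 0 ∧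
      Transcendental K ((s • v + t • w) i / (s • v + t • w) j) := by
  set P := s • v + t • w with hP
  have hP0 : P ≠ 0 := fun h => by
    have := LinearIndependent.pair_iff.1 hli s t h
    tauto
  obtain ⟨j, hj⟩ := Function.ne_iff.1 hP0
  by_contra! hcon
  have hκ : ∀ i, ∃ a : K, algebraMap K E a = P i / P j := fun i =>
    mem_range_algebraMap_of_isAlgebraic (not_not.1 (hcon i j hj))
  choose κ hκ using hκ
  obtain ⟨n, hnv, hnw, hnm⟩ := exists_orthogonal_not_smul hli m
  have hmn : LinearIndependent E ![m, n] := by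
    by_contra h
    obtain ⟨c, hc⟩ := eq_smul_or_pair hm h
    exact hnm c hc
  have := hvw.eq_zero_of_pair hmn hmdv hmdw (ξ := s) (η := t) fun D => by
    rw [← dotProduct_derivation_point hnv hnw, ← hP]
    have : (fun i => D (P i)) = (D (P j) / P j) • P := by
      funext i
      have hi : P i = κ i • P j := by rw [Algebra.smul_def, hκ, div_mul_cancel₀ _ hj]
      rw [Pi.smul_apply, hi, D.map_smul, smul_eq_mul, mul_smul_comm, div_mul_cancel₀ _ hj]
    rw [this, dotProduct_smul, hP, dotProduct_add, dotProduct_smul, dotProduct_smul, hnv, hnw]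
    simp
  tauto

/-- Three points moving on the line `⟨v, w⟩`, each infinitesimally inside a plane `m k` through the
line: the plane is common to them and defined over the base field, and the points do move. -/
theorem AtMostTwoRelations.exists_constant_plane [IsAlgClosed K]
    (hex : ∀ z : E, Transcendental K z → ∃ D : Derivation K E E, D z ≠ 0) {v w : Fin 4 → E}
    (hvw : AtMostTwoRelations K v w) (hli : LinearIndependent E ![v, w])
    {s t : Fin 3 → E} (hst : ∀ i j, i ≠ j → s i * t j - s j * t i ≠ 0) {m : Fin 3 → Fin 4 → E}
    (hm : ∀ k, m k ≠ 0) (hmv : ∀ k, m k ⬝ᵥ v = 0) (hmw : ∀ k, m k ⬝ᵥ w = 0)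
    (hmd : ∀ k, ∀ D : Derivation K E E,
      m k ⬝ᵥ (fun i => D ((s k • v + t k • w) i)) = 0) :
    (∃ (μ : Fin 4 → K) (c : E), μ ≠ 0 ∧ c ≠ 0 ∧ m 0 = c • fun i => algebraMap K E (μ i)) ∧
      ∃ i j, (s 0 • v + t 0 • w) j ≠ 0 ∧
        Transcendental K ((s 0 • v + t 0 • w) i / (s 0 • v + t 0 • w) j) := by
  obtain ⟨c, hc⟩ := hvw.exists_eq_smul hst hm hmv hmw hmd
  have hc0 : c ≠ 0 := fun h => hm 1 (by rw [hc, h, zero_smul])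
  have hmd' : ∀ D : Derivation K E E, m 0 ⬝ᵥ (fun i => D (v i)) = 0 ∧
      m 0 ⬝ᵥ (fun i => D (w i)) = 0 := fun D => by
    have h0 := hmd 0 D
    have h1 := hmd 1 D
    rw [hc, smul_dotProduct, smul_eq_zero, or_iff_right hc0] at h1
    rw [dotProduct_derivation_point (hmv 0) (hmw 0)] at h0 h1
    have hne := hst 0 1 (by decide)
    exact ⟨(mul_eq_zero.1 (by linear_combination t 1 * h0 - t 0 * h1 :
        (s 0 * t 1 - s 1 * t 0) * (m 0 ⬝ᵥ fun i => D (v i)) = 0)).resolve_left hne,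
      (mul_eq_zero.1 (by linear_combination s 0 * h1 - s 1 * h0 :
        (s 0 * t 1 - s 1 * t 0) * (m 0 ⬝ᵥ fun i => D (w i)) = 0)).resolve_left hne⟩
  refine ⟨?_, hvw.exists_transcendental_ratio hli (hm 0) (fun D => (hmd' D).1)
    (fun D => (hmd' D).2) ?_⟩
  · obtain ⟨j, hj⟩ := Function.ne_iff.1 (hm 0)
    have hj : m 0 j ≠ 0 := hj
    have hder := hvw.derivation_eq_zero (m := (m 0 j)⁻¹ • m 0) hli (j := j) (by simp [hj])
      (by rw [smul_dotProduct, hmv, smul_zero]) (by rw [smul_dotProduct, hmw, smul_zero])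
      (fun D => by rw [smul_dotProduct, (hmd' D).1, smul_zero])
      (fun D => by rw [smul_dotProduct, (hmd' D).2, smul_zero])
    have hμ : ∀ i, ∃ a : K, algebraMap K E a = ((m 0 j)⁻¹ • m 0) i := fun i =>
      mem_range_algebraMap_of_forall_derivation hex fun D => congr_fun (hder D) i
    choose μ hμ using hμ
    refine ⟨μ, m 0 j, fun h => ?_, hj, ?_⟩
    · have := hμ j
      simp [h, hj] at this
    · funext i
      rw [Pi.smul_apply, hμ, Pi.smul_apply, smul_smul, mul_inv_cancel₀ hj, one_smul]
  · by_contra! h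
    exact hst 0 1 (by decide) (by simp [h.1, h.2])

end

section
variable {K E : Type*} [Field K] [Field E] [Algebra K E]

theorem derivation_aeval {σ : Type*} [Fintype σ] (D : Derivation K E E) (x : σ → E)
    (f : MvPolynomial σ K) : D (aeval x f) = ∑ i, aeval x (pderiv i f) * D (x i) := by
  classical
  induction f using MvPolynomial.induction_on with
  | C a => simp [← algebraMap_eq]
  | add p q hp hq => simp [hp, hq, add_mul, Finset.sum_add_distrib]
  | mul_X p j hp =>
    simp only [map_mul, aeval_X, Derivation.leibniz, hp, smul_eq_mul, map_add, pderiv_X, add_mul,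
      Finset.sum_add_distrib, Finset.mul_sum]
    congr 1
    · rw [Finset.sum_eq_single j]
      · simp
      · intro b _ hb
        simp [Pi.single_eq_of_ne hb.symm]
      · simp
    · exact Finset.sum_congr rfl fun i _ => by ring

theorem atMostTwoRelations_of_algebraicIndependent [CharZero K] (x : Fin 2 × Fin 4 → E)
    (y : Fin 6 → MvPolynomial (Fin 2 × Fin 4) K)
    (hy : AlgebraicIndependent K fun a => aeval x (y a)) :
    AtMostTwoRelations K (fun j => x (0, j)) (fun j => x (1, j)) := by
  classical
  intro α β hαβ
  have hD : ∀ a : Fin 6, ∃ D : Derivation K E E, ∀ b,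
      D (aeval x (y b)) = (Pi.single a (1 : E) : Fin 6 → E) b := fun a =>
    exists_derivation_of_algebraicIndependent hy _
  choose D hD using hD
  let d : Fin 6 → Fin 2 × Fin 4 → E := fun a q => D a (x q)
  have hd : LinearIndependent E d := by
    rw [Fintype.linearIndependent_iff]
    intro c hc b
    have hsum : ∀ z, (∑ a, c a • D a) z = ∑ a, c a * D a z := fun z => by
      have := congr_fun (map_sum Derivation.coeFnAddMonoidHom (fun a => c a • D a) Finset.univ) z
      rw [Finset.sum_apply] at this
      exact this
    have h1 : (∑ a, c a • D a) (aeval x (y b)) = c b := by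
      rw [hsum, Finset.sum_eq_single b]
      · simp [hD]
      · intro a _ hab
        simp [hD, Pi.single_eq_of_ne hab.symm]
      · simp
    rw [← h1, derivation_aeval]
    refine Finset.sum_eq_zero fun q _ => ?_
    have h2 := congr_fun hc q
    have h3 : (∑ a, c a • D a) (x q) = 0 := by
      rw [hsum]
      simpa [d] using h2
    rw [h3, mul_zero]
  let M : Matrix (Fin 3) (Fin 2 × Fin 4) E :=
    Matrix.of fun k q => ![α k, β k] q.1 q.2
  have hM : ¬ LinearIndependent E M.row := fun hM => by
    have h1 := LinearMap.finrank_range_add_finrank_ker M.mulVecLin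
    have h2 : M.rank = 3 := by simpa using LinearIndependent.rank_matrix hM
    rw [Matrix.rank] at h2
    have h3 : ∀ a, d a ∈ LinearMap.ker M.mulVecLin := fun a => by
      rw [LinearMap.mem_ker, Matrix.mulVecLin_apply]
      funext k
      have := hαβ k (D a)
      simpa [Matrix.mulVec, dotProduct, Fintype.sum_prod_type, M, d] using this
    have h4 : Submodule.span E (Set.range d) ≤ LinearMap.ker M.mulVecLin :=
      Submodule.span_le.2 (by rintro _ ⟨a, rfl⟩; exact h3 a)
    have h5 := Submodule.finrank_mono h4
    rw [finrank_span_eq_card hd] at h5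
    simp only [Module.finrank_fintype_fun_eq_card, Fintype.card_prod, Fintype.card_fin] at h1 h5
    omega
  obtain ⟨c, hc, k, hk⟩ := Fintype.not_linearIndependent_iff.1 hM
  refine ⟨c, fun h => hk (by simp [h]), ?_, ?_⟩
  · funext j
    simpa [M] using congr_fun hc (0, j)
  · funext j
    simpa [M] using congr_fun hc (1, j)

end

theorem exists_ultrafilter_of_isPrime {K σ : Type*} [Field K] {F : Set (σ → K)}
    {I : Ideal (MvPolynomial σ K)} (hI : I.IsPrime)
    (hF : ∀ f, f ∈ I ↔ ∀ p ∈ F, eval p f = 0) :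
    ∃ 𝒰 : Ultrafilter (σ → K), (∀ᶠ p in (𝒰 : Filter (σ → K)), p ∈ F) ∧
      ∀ f, f ∉ I → ∀ᶠ p in (𝒰 : Filter (σ → K)), eval p f ≠ 0 := by
  let 𝓕 : Filter (σ → K) :=
    { sets := {A | ∃ f, f ∉ I ∧ ∀ p ∈ F, eval p f ≠ 0 → p ∈ A}
      univ_sets := ⟨1, (Ideal.ne_top_iff_one I).1 hI.ne_top, fun _ _ _ => trivial⟩
      sets_of_superset := fun ⟨f, hf, h⟩ hAB => ⟨f, hf, fun p hp hpf => hAB (h p hp hpf)⟩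
      inter_sets := fun ⟨f, hf, h⟩ ⟨g, hg, h'⟩ => ⟨f * g, hI.mul_notMem hf hg, fun p hp hpf => by
        rw [map_mul] at hpf
        exact ⟨h p hp (left_ne_zero_of_mul hpf), h' p hp (right_ne_zero_of_mul hpf)⟩⟩ }
  have hne : 𝓕.NeBot := by
    rw [Filter.neBot_iff, Ne, ← Filter.empty_mem_iff_bot]
    rintro ⟨f, hf, h⟩
    exact hf ((hF f).2 fun p hp => by_contra fun h0 => h p hp h0)
  refine ⟨Ultrafilter.of 𝓕, Ultrafilter.of_le 𝓕 ?_, fun f hf => Ultrafilter.of_le 𝓕 ?_⟩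
  · exact ⟨1, (Ideal.ne_top_iff_one I).1 hI.ne_top, fun p hp _ => hp⟩
  · exact ⟨f, hf, fun p _ hp => hp⟩

section
variable {K σ : Type*} [Field K]

instance {X : Type*} (l : Ultrafilter X) : Algebra K (Filter.Germ (l : Filter X) K) :=
  ((Filter.Germ.coeRingHom (l : Filter X)).comp (Pi.constRingHom X K)).toAlgebra

theorem germ_aeval {X : Type*} (l : Ultrafilter X) (φ : σ → X → K) (f : MvPolynomial σ K) :
    aeval (fun i => (φ i : Filter.Germ (l : Filter X) K)) f =
      ((fun p => eval (fun i => φ i p) f : X → K) : Filter.Germ (l : Filter X) K) := by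
  induction f using MvPolynomial.induction_on with
  | C a => simp only [aeval_C, eval_C]; rfl
  | add p q hp hq => simp only [map_add, hp, hq]; rfl
  | mul_X p i hp => simp only [map_mul, hp, aeval_X, eval_X]; rfl

theorem germ_dotProduct {X ι : Type*} [Fintype ι] (l : Ultrafilter X) (φ ψ : ι → X → K) :
    (fun i => (φ i : Filter.Germ (l : Filter X) K)) ⬝ᵥ
        (fun i => (ψ i : Filter.Germ (l : Filter X) K)) =
      ((fun p => (fun i => φ i p) ⬝ᵥ (fun i => ψ i p) : X → K) : Filter.Germ (l : Filter X) K) := by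
  have := map_sum (Filter.Germ.coeRingHom (R := K) (l : Filter X)) (fun i => φ i * ψ i) Finset.univ
  refine this.symm.trans (congrArg _ ?_)
  funext p
  simp [dotProduct]

end

section Frames

variable {K : Type} [Field K]

/-- Substitution of the frames `(∑ l, q (i, l) • b l)ᵢ` in a polynomial in frame coordinates. -/
def frameSubst {k N d : ℕ} (b : Fin d → Fin (N + 1) → K) :
    MvPolynomial (Fin k × Fin (N + 1)) K →ₐ[K] MvPolynomial (Fin k × Fin d) K :=
  aeval fun q => ∑ l, C (b l q.2) * X (q.1, l)

theorem eval_frameSubst {k N d : ℕ} (b : Fin d → Fin (N + 1) → K) (q : Fin k × Fin d → K)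
    (f : MvPolynomial (Fin k × Fin (N + 1)) K) :
    eval q (frameSubst b f) = eval (fun ij => ∑ l, b l ij.2 * q (ij.1, l)) f := by
  induction f using MvPolynomial.induction_on with
  | C a => simp [frameSubst, ← algebraMap_eq]
  | add p q hp hq => simp only [map_add, hp, hq]
  | mul_X p i hp => simp only [map_mul, hp, eval_X]; simp [frameSubst]

theorem frameSubst_eq_zero_iff [Infinite K] {k N d : ℕ} {W : Submodule K (Fin (N + 1) → K)}
    (b : Module.Basis (Fin d) K W) (f : MvPolynomial (Fin k × Fin (N + 1)) K) :
    frameSubst (fun l => (b l : Fin (N + 1) → K)) f = 0 ↔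
      ∀ p, frameMem K p W → eval p f = 0 := by
  constructor
  · intro h p hp
    have := eval_frameSubst (fun l => (b l : Fin (N + 1) → K))
      (fun il => b.repr ⟨_, hp il.1⟩ il.2) f
    rw [h, map_zero] at this
    rw [this]
    congr 1
    congr 1
    funext ij
    have h2 := congr_fun (congrArg Subtype.val (b.sum_repr ⟨_, hp ij.1⟩)) ij.2
    simp only [Submodule.coe_sum, Submodule.coe_smul, Finset.sum_apply, Pi.smul_apply,
      smul_eq_mul] at h2
    rw [← h2]
    exact Finset.sum_congr rfl fun l _ => mul_comm _ _
  · intro h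
    refine MvPolynomial.funext fun q => ?_
    rw [eval_frameSubst, map_zero]
    refine h _ fun i => ?_
    have : (fun j => ∑ l, (b l : Fin (N + 1) → K) j * q (i, l)) =
        ∑ l, q (i, l) • (b l : Fin (N + 1) → K) := by
      funext j
      simp [mul_comm]
    change (fun j => ∑ l, (b l : Fin (N + 1) → K) j * q (i, l)) ∈ W
    rw [this]
    exact Submodule.sum_mem _ fun l _ => W.smul_mem _ (b l).2

theorem frameSubst_surjective {k N d : ℕ} {W : Submodule K (Fin (N + 1) → K)}
    (b : Module.Basis (Fin d) K W) :
    Function.Surjective (frameSubst (k := k) fun l => (b l : Fin (N + 1) → K)) := by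
  obtain ⟨L, hL⟩ := (b.equivFun.toLinearMap).exists_extend
  have hb : ∀ l l', L (b l) l' = (Pi.single l 1 : Fin d → K) l' := fun l l' => by
    have h1 := LinearMap.congr_fun hL (b l)
    have : L (b l) = b.equivFun (b l) := h1
    rw [this, b.equivFun_self, Pi.single_apply]
    simp [eq_comm]
  rw [← AlgHom.range_eq_top, eq_top_iff, ← adjoin_range_X, Algebra.adjoin_le_iff]
  rintro _ ⟨⟨i, l'⟩, rfl⟩
  refine ⟨∑ j, C (L (Pi.single j 1) l') * X (i, j), ?_⟩
  have hx : ∀ l, ∑ j, L (Pi.single j 1) l' * (b l : Fin (N + 1) → K) j =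
      (Pi.single l 1 : Fin d → K) l' := fun l => by
    rw [← hb l l']
    conv_rhs => rw [pi_eq_sum_univ' (b l : Fin (N + 1) → K), map_sum, Finset.sum_apply]
    refine Finset.sum_congr rfl fun j _ => ?_
    rw [map_smul, Pi.smul_apply, smul_eq_mul, mul_comm]
  change frameSubst _ _ = _
  simp only [frameSubst, map_sum, map_mul, aeval_X, ← algebraMap_eq, AlgHom.commutes,
    Finset.mul_sum]
  rw [Finset.sum_comm]
  simp only [← mul_assoc, ← map_mul, ← Finset.sum_mul, ← map_sum, hx, Pi.single_apply, apply_ite,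
    map_one, map_zero, ite_mul, one_mul, zero_mul]
  simp

theorem affVanishing_frameCone_isPrime [Infinite K] {k N : ℕ} {H : Set (Grass K k N)}
    (hirr : GrIrred K H) : (affVanishing K (frameCone K k N H)).IsPrime := by
  refine ⟨fun h => ?_, fun {f g} hfg => ?_⟩
  · obtain ⟨W, hW⟩ := hirr.1
    have h1 : (1 : MvPolynomial (Fin k × Fin (N + 1)) K) ∈ affVanishing K (frameCone K k N H) := by
      rw [h]; trivial
    have := h1 0 ⟨W, hW, fun i => W.1.zero_mem⟩
    simp at this
  · let Z (e : MvPolynomial (Fin k × Fin (N + 1)) K) : Set (Grass K k N) :=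
      {W | ∀ p, frameMem K p W.1 → eval p e = 0}
    have hZ : ∀ e, GrClosed K (Z e) := fun e => ⟨{e}, by simp [Z]⟩
    have hmem : ∀ e, H ⊆ Z e → e ∈ affVanishing K (frameCone K k N H) := by
      rintro e he p ⟨W, hW, hp⟩
      exact he hW p hp
    refine (hirr.2 (Z f) (Z g) (hZ f) (hZ g) fun W hW => ?_).imp (hmem f) (hmem g)
    let b := Module.finBasisOfFinrankEq K W.1 W.2
    have h0 := (frameSubst_eq_zero_iff b (f * g)).2 fun p hp => hfg p ⟨W, hW, hp⟩
    rw [map_mul] at h0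
    exact (mul_eq_zero.1 h0).imp (frameSubst_eq_zero_iff b f).1 (frameSubst_eq_zero_iff b g).1

theorem ringKrullDim_quotient_affVanishing_frameMem [Infinite K] {k N d : ℕ}
    {W : Submodule K (Fin (N + 1) → K)} (hW : Module.finrank K W = d) :
    ringKrullDim (MvPolynomial (Fin k × Fin (N + 1)) K ⧸ affVanishing K {p | frameMem K p W}) =
      ((k * d : ℕ) : WithBot ℕ∞) ∧ (affVanishing K {p | frameMem (k := k) K p W}).IsPrime := by
  let b := Module.finBasisOfFinrankEq K W hW
  let φ := frameSubst (k := k) fun l => (b l : Fin (N + 1) → K)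
  have hker : affVanishing K {p | frameMem K p W} = RingHom.ker φ := by
    ext f
    rw [RingHom.mem_ker, frameSubst_eq_zero_iff]
    rfl
  rw [hker]
  refine ⟨?_, RingHom.ker_isPrime φ⟩
  rw [ringKrullDim_eq_of_ringEquiv
    (Ideal.quotientKerAlgEquivOfSurjective (f := φ) (frameSubst_surjective b)).toRingEquiv,
    MvPolynomial.ringKrullDim_of_isNoetherianRing, ringKrullDim_eq_zero_of_field, zero_add]
  simp

theorem eq_of_le_of_ringKrullDim_le {R : Type*} [CommRing R] {I J : Ideal R} (hI : I.IsPrime)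
    (hIJ : I ≤ J) {n : ℕ} (h₁ : ringKrullDim (R ⧸ I) = n) (h₂ : n ≤ ringKrullDim (R ⧸ J)) :
    I = J := by
  by_contra hne
  obtain ⟨x, hxJ, hxI⟩ := SetLike.exists_of_lt (lt_of_le_of_ne hIJ hne)
  have := ringKrullDim_succ_le_of_surjective (Ideal.Quotient.factor hIJ)
    (Ideal.Quotient.factor_surjective hIJ) (r := Ideal.Quotient.mk I x)
    (mem_nonZeroDivisors_of_ne_zero (by rwa [Ne, Ideal.Quotient.eq_zero_iff_mem]))
    (by rwa [Ideal.Quotient.factor_mk, Ideal.Quotient.eq_zero_iff_mem])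
  rw [h₁] at this
  have h3 : (n : WithBot ℕ∞) + 1 ≤ n := (add_le_add_left h₂ 1).trans this
  have h4 : ((n + 1 : ℕ) : WithBot ℕ∞) ≤ (n : ℕ) := by exact_mod_cast h3
  have : n + 1 ≤ n := by exact_mod_cast h4
  omega

/-- The lines of a family of dimension at least two that lie in a plane `M` are dense in the
dual plane of `M`. -/
theorem affVanishing_frameCone_eq [Infinite K] {H : Set (Grass K 2 3)} (hdim : GrDimGE K H 2)
    {M : Submodule K (Fin 4 → K)} (hM : Module.finrank K M = 3) (hHM : ∀ W ∈ H, W.1 ≤ M) :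
    affVanishing K (frameCone K 2 3 H) = affVanishing K {p | frameMem K p M} := by
  obtain ⟨h1, h2⟩ := ringKrullDim_quotient_affVanishing_frameMem (k := 2) hM
  refine (eq_of_le_of_ringKrullDim_le h2 ?_ h1 hdim).symm
  rintro f hf p ⟨W, hW, hp⟩
  exact hf p fun i => hHM W hW (hp i)

theorem hasGrDim_two_of_le [Infinite K] {H : Set (Grass K 2 3)} (hdim : GrDimGE K H 2)
    {M : Submodule K (Fin 4 → K)} (hM : Module.finrank K M = 3) (hHM : ∀ W ∈ H, W.1 ≤ M) :
    HasGrDim K H 2 := by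
  rw [HasGrDim, affDim, affVanishing_frameCone_eq hdim hM hHM]
  exact (ringKrullDim_quotient_affVanishing_frameMem (k := 2) hM).1

theorem grClosure_eq_of_le [Infinite K] {H : Set (Grass K 2 3)} (hdim : GrDimGE K H 2)
    {μ : Fin 4 → K} {M : Submodule K (Fin 4 → K)} (hμ : ∀ z, z ∈ M ↔ μ ⬝ᵥ z = 0)
    (hM : Module.finrank K M = 3) (hHM : ∀ W ∈ H, W.1 ≤ M) :
    grClosure K H = {W : Grass K 2 3 | W.1 ≤ M} := by
  refine Set.Subset.antisymm (Set.sInter_subset_of_mem ⟨?_, hHM⟩) ?_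
  · refine ⟨{∑ j, C (μ j) * X (0, j)}, Set.ext fun W => ?_⟩
    simp only [Set.mem_ofPred_eq, Set.mem_singleton_iff, forall_eq, map_sum, map_mul, eval_C,
      eval_X]
    refine ⟨fun h p hp => (hμ _).1 (h (hp 0)), fun h z hz => (hμ z).2 ?_⟩
    exact h (fun ij => z ij.2) fun _ => hz
  · rintro W hW _ ⟨⟨𝒢, rfl⟩, hH𝒢⟩ g hg p hp
    have : g ∈ affVanishing K (frameCone K 2 3 H) := by
      rintro q ⟨W', hW', hq⟩
      exact hH𝒢 hW' g hg q hq
    rw [affVanishing_frameCone_eq hdim hM hHM] at this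
    exact this p fun i => hW (hp i)

end Frames

theorem linearIndependent_pair_of_minor_ne_zero {F : Type*} [Field F] {v w : Fin 4 → F}
    {i j : Fin 4} (h : v i * w j - v j * w i ≠ 0) : LinearIndependent F ![v, w] := by
  rw [LinearIndependent.pair_iff]
  intro s t hst
  have hi := congr_fun hst i
  have hj := congr_fun hst j
  simp only [Pi.add_apply, Pi.smul_apply, smul_eq_mul, Pi.zero_apply] at hi hj
  exact ⟨(mul_eq_zero.1 (by linear_combination w j * hi - w i * hj :
      s * (v i * w j - v j * w i) = 0)).resolve_right h,
    (mul_eq_zero.1 (by linear_combination v i * hj - v j * hi :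
      t * (v i * w j - v j * w i) = 0)).resolve_right h⟩

theorem exists_minor_ne_zero {F : Type*} [Field F] {v w : Fin 4 → F}
    (h : LinearIndependent F ![v, w]) : ∃ i j, v i * w j - v j * w i ≠ 0 := by
  by_contra! hcon
  have hv : v ≠ 0 := h.ne_zero 0
  obtain ⟨i, hi⟩ := Function.ne_iff.1 hv
  have hi : v i ≠ 0 := hi
  have := (LinearIndependent.pair_iff.1 h (w i) (-v i) (by
    funext j
    simp only [Pi.add_apply, Pi.smul_apply, smul_eq_mul, Pi.zero_apply]
    linear_combination -hcon i j)).2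
  exact hi (neg_eq_zero.1 this)

section Tangency

variable {K : Type} [Field K]

theorem gradVec_dotProduct_eq_zero {N : ℕ} {T : Set (MvPolynomial (Fin (N + 1)) K)}
    {u w : Fin (N + 1) → K} (hT : ∀ g ∈ T, eval u g = 0)
    (hw : ∀ g ∈ T, gradVec K g u ⬝ᵥ w = 0) :
    ∀ f ∈ Ideal.span T, gradVec K f u ⬝ᵥ w = 0 := by
  have h : ∀ f ∈ Ideal.span T, eval u f = 0 ∧ gradVec K f u ⬝ᵥ w = 0 := fun f hf => by
    induction hf using Submodule.span_induction with
    | mem g hg => exact ⟨hT g hg, hw g hg⟩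
    | zero => simp [gradVec, dotProduct]
    | add f g _ _ hf hg =>
      refine ⟨by simp [hf.1, hg.1], ?_⟩
      have : gradVec K (f + g) u = gradVec K f u + gradVec K g u := by
        funext i
        simp [gradVec]
      rw [this, add_dotProduct, hf.2, hg.2, add_zero]
    | smul a f _ hf =>
      refine ⟨by simp [hf.1], ?_⟩
      have : gradVec K (a • f) u = eval u a • gradVec K f u := by
        funext i
        simp [gradVec, Derivation.leibniz, hf.1]
      rw [this, smul_dotProduct, hf.2, smul_zero]
  exact fun f hf => (h f hf).2

theorem mem_affVanishing_projCone_iff {N : ℕ} {S : Set (PP K N)}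
    {f : MvPolynomial (Fin (N + 1)) K} :
    f ∈ affVanishing K (projCone K S) ↔ f ∈ homVanishing K S :=
  ⟨fun h x hx v hv => h v ⟨x, hx, hv⟩, fun h v ⟨x, hx, hv⟩ => h x hx v hv⟩

theorem exists_gradVec_dotProduct_ne_zero [Infinite K] {N : ℕ} {S : Set (PP K N)} {P y : PP K N}
    (h : y ∉ projTangentAt K S P) :
    ∃ f ∈ homVanishing K S, ∃ u ∈ P.submodule, u ≠ 0 ∧ ∃ w, gradVec K f u ⬝ᵥ w ≠ 0 := by
  simp only [projTangentAt, Set.mem_ofPred_eq, not_forall] at h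
  obtain ⟨f, hf, u, hu, w, -, hne⟩ := h
  by_cases hu0 : u = 0
  · subst hu0
    let φ : Polynomial K := ∑ i, Polynomial.C (w i) *
      aeval (fun j => Polynomial.C (P.rep j) * Polynomial.X) (pderiv i f)
    have hφ : ∀ c, φ.eval c = gradVec K f (c • P.rep) ⬝ᵥ w := fun c => by
      simp only [φ, Polynomial.eval_finsetSum, Polynomial.eval_mul, Polynomial.eval_C, dotProduct,
        gradVec]
      refine Finset.sum_congr rfl fun i _ => ?_
      rw [mul_comm]
      congr 1
      have h1 := MvPolynomial.map_aeval (fun j => Polynomial.C (P.rep j) * Polynomial.X)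
        (Polynomial.evalRingHom c) (pderiv i f)
      rw [Polynomial.coe_evalRingHom] at h1
      have h2 : (Polynomial.evalRingHom c).comp (algebraMap K (Polynomial K)) = RingHom.id K := by
        refine RingHom.ext fun a => ?_
        simp
      rw [h1, h2]
      change eval _ _ = eval _ _
      congr 2
      funext j
      rw [Polynomial.eval_mul, Polynomial.eval_C, Polynomial.eval_X,
        Pi.smul_apply, smul_eq_mul, mul_comm]
    have hφ0 : Polynomial.X * φ ≠ 0 := by
      refine mul_ne_zero Polynomial.X_ne_zero fun h0 => hne ?_
      have := hφ 0
      rw [h0, zero_smul, Polynomial.eval_zero] at this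
      exact this.symm
    obtain ⟨c, hc⟩ : ∃ c, (Polynomial.X * φ).eval c ≠ 0 := by
      by_contra! hcon
      exact hφ0 (Polynomial.funext fun c => by simpa using hcon c)
    rw [Polynomial.eval_mul, Polynomial.eval_X] at hc
    refine ⟨f, hf, c • P.rep, ?_, ?_, w, ?_⟩
    · exact Submodule.smul_mem _ _ (P.submodule_eq ▸ Submodule.mem_span_singleton_self _)
    · exact smul_ne_zero (left_ne_zero_of_mul hc) P.rep_nonzero
    · rw [← hφ]; exact right_ne_zero_of_mul hc
  · exact ⟨f, hf, u, hu, hu0, w, hne⟩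

/-- The point `s • v + t • w` of the line spanned by the frame `p = (v, w)`. -/
def framePoint (p : Fin 2 × Fin 4 → K) (s t : K) : Fin 4 → K :=
  s • (fun j => p (0, j)) + t • fun j => p (1, j)

/-- The equation `f` witnesses the tangency to `S` of the line spanned by the frame `p` at the
point with parameters `(s, t)`. -/
def TangencyWitness (S : Set (PP K 3)) (p : Fin 2 × Fin 4 → K) (f : MvPolynomial (Fin 4) K)
    (s t : K) : Prop :=
  gradVec K f (framePoint p s t) ≠ 0 ∧
    (gradVec K f (framePoint p s t) ⬝ᵥ fun j => p (0, j)) = 0 ∧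
    (gradVec K f (framePoint p s t) ⬝ᵥ fun j => p (1, j)) = 0 ∧
    ∃ x ∈ S, framePoint p s t ∈ x.submodule ∧
      ∀ y ∈ projTangentAt K S x, ∀ z ∈ y.submodule, gradVec K f (framePoint p s t) ⬝ᵥ z = 0

theorem submodule_mk {N : ℕ} {z : Fin (N + 1) → K} (hz : z ≠ 0) :
    (Projectivization.mk K z hz).submodule = Submodule.span K {z} :=
  Projectivization.submodule_mk z hz

theorem submodule_eq_span {N : ℕ} {u : Fin (N + 1) → K} {x : PP K N} (hu : u ≠ 0)
    (hux : u ∈ x.submodule) : x.submodule = Submodule.span K {u} := by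
  induction x using Projectivization.ind with
  | h z hz =>
    rw [submodule_mk] at hux ⊢
    obtain ⟨c, rfl⟩ := Submodule.mem_span_singleton.1 hux
    exact (Submodule.span_singleton_smul_eq (IsUnit.mk0 c fun hc => hu (by simp [hc])) z).symm

theorem span_frame_eq {W : Grass K 2 3} {p : Fin 2 × Fin 4 → K} (hp : frameMem K p W.1)
    (hli : LinearIndependent K ![fun j => p (0, j), fun j => p (1, j)]) :
    Submodule.span K {fun j => p (0, j), fun j => p (1, j)} = W.1 := by
  refine Submodule.eq_of_le_of_finrank_eq (Submodule.span_le.2 ?_) ?_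
  · rintro x (rfl | rfl)
    exacts [hp 0, hp 1]
  · have := finrank_span_eq_card hli
    rw [Matrix.range_cons_cons_empty, Fintype.card_fin] at this
    rw [this, W.2]

theorem IsTangentLineAt.exists_witness [Infinite K] {S : Set (PP K 3)} {W : Grass K 2 3}
    {P : PP K 3} (h : IsTangentLineAt K S W P) {T : Set (MvPolynomial (Fin 4) K)}
    (hT : Ideal.span T = affVanishing K (projCone K S)) {p : Fin 2 × Fin 4 → K}
    (hp : frameMem K p W.1)
    (hli : LinearIndependent K ![fun j => p (0, j), fun j => p (1, j)]) :
    ∃ f ∈ T, ∃ s t : K, framePoint p s t ≠ 0 ∧ framePoint p s t ∈ P.submodule ∧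
      TangencyWitness S p f s t := by
  obtain ⟨⟨hPS, V, hV, hVT⟩, hPW, hWT⟩ := h
  obtain ⟨z, hz⟩ : ∃ z, z ∉ V := by
    by_contra! hcon
    have : V = ⊤ := eq_top_iff.2 fun z _ => hcon z
    rw [this, finrank_top, Module.finrank_fin_fun] at hV
    omega
  have hz0 : z ≠ 0 := fun h0 => hz (h0 ▸ V.zero_mem)
  have hy : Projectivization.mk K z hz0 ∉ projTangentAt K S P := by
    rw [hVT]
    intro hle
    have hle : (Projectivization.mk K z hz0).submodule ≤ V := hle
    rw [submodule_mk, Submodule.span_singleton_le_iff_mem] at hle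
    exact hz hle
  obtain ⟨f, hf, u, hu, hu0, w, hfw⟩ := exists_gradVec_dotProduct_ne_zero hy
  have huT : ∀ g ∈ T, eval u g = 0 := fun g hg =>
    mem_affVanishing_projCone_iff.1 (hT ▸ Ideal.subset_span hg) P hPS u hu
  obtain ⟨g, hg, hgw⟩ : ∃ g ∈ T, gradVec K g u ⬝ᵥ w ≠ 0 := by
    by_contra! hcon
    exact hfw (gradVec_dotProduct_eq_zero huT hcon f
      (hT ▸ mem_affVanishing_projCone_iff.2 hf))
  have hgS : g ∈ homVanishing K S :=
    mem_affVanishing_projCone_iff.1 (hT ▸ Ideal.subset_span hg)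
  have huW : u ∈ W.1 := hPW hu
  rw [← span_frame_eq hp hli, Submodule.mem_span_pair] at huW
  obtain ⟨s, t, hst⟩ := huW
  have hst : framePoint p s t = u := hst
  have hW0 : ∀ x ∈ W.1, gradVec K g u ⬝ᵥ x = 0 := fun x hx => by
    by_cases hx0 : x = 0
    · rw [hx0, dotProduct_zero]
    · have hm : Projectivization.mk K x hx0 ∈ projLinear K W.1 := by
        change (Projectivization.mk K x hx0).submodule ≤ W.1
        rwa [submodule_mk, Submodule.span_singleton_le_iff_mem]
      exact hWT hm g hgS u hu x (by rw [submodule_mk]; exact Submodule.mem_span_singleton_self x)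
  refine ⟨g, hg, s, t, by rwa [hst], by rwa [hst], ?_⟩
  rw [TangencyWitness, hst]
  exact ⟨fun h0 => hgw (by rw [h0, zero_dotProduct]), hW0 _ (hp 0), hW0 _ (hp 1), P, hPS, hu,
    fun y hy z hz => hy g hgS u hu z hz⟩

theorem minor_ne_zero_of_ne {p : Fin 2 × Fin 4 → K} {s t s' t' : K} {P Q : PP K 3} (hPQ : P ≠ Q)
    (h0 : framePoint p s t ≠ 0) (hP : framePoint p s t ∈ P.submodule)
    (h0' : framePoint p s' t' ≠ 0) (hQ : framePoint p s' t' ∈ Q.submodule) :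
    s * t' - s' * t ≠ 0 := by
  intro hzero
  have hst : s' ≠ 0 ∨ t' ≠ 0 := by
    by_contra! h
    exact h0' (by simp [framePoint, h.1, h.2])
  have hex : ∃ c : K, framePoint p s t = c • framePoint p s' t' := by
    rcases hst with h | h
    · refine ⟨s / s', ?_⟩
      funext j
      simp only [framePoint, Pi.add_apply, Pi.smul_apply, smul_eq_mul]
      field_simp
      linear_combination -p (1, j) * hzero
    · refine ⟨t / t', ?_⟩
      funext j
      simp only [framePoint, Pi.add_apply, Pi.smul_apply, smul_eq_mul]
      field_simp
      linear_combination p (0, j) * hzero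
  obtain ⟨c, hc⟩ := hex
  have hPQ' : framePoint p s t ∈ Q.submodule := hc ▸ Q.submodule.smul_mem c hQ
  exact hPQ (Projectivization.submodule_injective
    ((submodule_eq_span h0 hP).trans (submodule_eq_span h0 hPQ').symm))

end Tangency

section Cone

theorem comp_aeval_fin_two {K B C : Type*} [Field K] [CommRing B] [CommRing C] [Algebra K B]
    [Algebra K C] (φ : B →ₐ[K] C) (a b : B) (g : MvPolynomial (Fin 2) K) :
    φ (aeval ![a, b] g) = aeval ![φ a, φ b] g := by
  rw [← AlgHom.comp_apply]
  congr 1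
  refine algHom_ext fun i => ?_
  fin_cases i <;> simp

/-- The affine cone over a nonconstant point is two-dimensional. -/
theorem algebraicIndependent_cone {K E : Type*} [Field K] [Infinite K] [Field E] [Algebra K E]
    {a b : E} (hb : b ≠ 0) (hab : Transcendental K (a / b)) :
    AlgebraicIndependent K ![Polynomial.C a * Polynomial.X, Polynomial.C b * Polynomial.X] := by
  rw [algebraicIndependent_iff]
  intro g hg
  have h1 : ∀ κ : K, aeval ![algebraMap K E κ * (a / b), algebraMap K E κ] g = 0 := fun κ => by
    have hx : ∀ z : E, (Polynomial.aeval (R := E) (algebraMap K E κ / b)).restrictScalars K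
        (Polynomial.C z * Polynomial.X) = z * (algebraMap K E κ / b) := fun z => by
      change Polynomial.aeval _ _ = _
      simp
    have := congrArg ((Polynomial.aeval (R := E) (algebraMap K E κ / b)).restrictScalars K) hg
    rw [comp_aeval_fin_two, map_zero, hx, hx, mul_div_cancel₀ _ hb] at this
    rwa [mul_div_left_comm]
  have h2 : ∀ κ c : K, eval ![c * κ, κ] g = 0 := fun κ c => by
    let G : Polynomial K := aeval ![Polynomial.X * Polynomial.C κ, Polynomial.C κ] g
    have hG : G = 0 := by
      refine (transcendental_iff.1 hab) G ?_
      rw [comp_aeval_fin_two]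
      simpa using h1 κ
    have h3 := comp_aeval_fin_two (Polynomial.aeval c) (Polynomial.X * Polynomial.C κ)
      (Polynomial.C κ) g
    change Polynomial.aeval c G = _ at h3
    rw [hG, map_zero] at h3
    simp only [map_mul, Polynomial.aeval_X, Polynomial.aeval_C, Algebra.algebraMap_self,
      RingHom.id_apply] at h3
    rw [← MvPolynomial.aeval_eq_eval]
    exact h3.symm
  have h4 : g * X 1 = 0 := MvPolynomial.funext fun q => by
    rw [map_mul, eval_X, map_zero]
    by_cases hq : q 1 = 0
    · rw [hq, mul_zero]
    · have hq' : q = ![q 0 / q 1 * q 1, q 1] := by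
        funext i
        fin_cases i
        · simp [hq]
        · simp
      rw [hq', h2, zero_mul]
  exact (mul_eq_zero.1 h4).resolve_right (X_ne_zero 1)

theorem two_le_ringKrullDim_of_cone {K E : Type} [Field K] [Infinite K] [Field E] [Algebra K E]
    {n : ℕ} {J : Ideal (MvPolynomial (Fin n) K)} {u : Fin n → E}
    (hJ : ∀ f ∈ J, ∀ c : K, aeval (fun i => algebraMap K E c * u i) f = 0) {i j : Fin n}
    (hj : u j ≠ 0) (htr : Transcendental K (u i / u j)) :
    2 ≤ ringKrullDim (MvPolynomial (Fin n) K ⧸ J) := by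
  let Φ : MvPolynomial (Fin n) K →ₐ[K] Polynomial E :=
    aeval fun i => Polynomial.C (u i) * Polynomial.X
  have hΦ : ∀ f ∈ J, Φ f = 0 := fun f hf => by
    refine Polynomial.eq_zero_of_infinite_isRoot _ (Set.Infinite.mono ?_
      (Set.infinite_range_of_injective (algebraMap K E).injective))
    rintro _ ⟨c, rfl⟩
    have h1 : ((Polynomial.aeval (R := E) (algebraMap K E c)).restrictScalars K).comp Φ =
        aeval fun i => algebraMap K E c * u i :=
      algHom_ext fun i => by
        rw [AlgHom.comp_apply, aeval_X, aeval_X]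
        change Polynomial.aeval _ _ = _
        rw [map_mul, Polynomial.aeval_C, Polynomial.aeval_X, Algebra.algebraMap_self,
          RingHom.id_apply, mul_comm]
    have h2 := DFunLike.congr_fun h1 f
    rw [hJ f hf c] at h2
    simpa [Polynomial.IsRoot, Polynomial.coe_aeval_eq_eval] using h2
  have : Algebra.FiniteType K Φ.range :=
    .of_surjective Φ.rangeRestrict Φ.rangeRestrict_surjective
  have hind : AlgebraicIndependent K ![Φ.rangeRestrict (X i), Φ.rangeRestrict (X j)] := by
    refine (Φ.range.val.algebraicIndependent_iff Subtype.val_injective).1 ?_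
    convert algebraicIndependent_cone hj htr using 1
    funext l
    fin_cases l <;> simp [Φ]
  refine (two_le_ringKrullDim_of_algebraicIndependent K Φ.range _ hind).trans ?_
  refine ringKrullDim_le_of_surjective (Ideal.Quotient.lift J Φ.rangeRestrict.toRingHom
    fun f hf => Subtype.ext (hΦ f hf)) ?_
  exact Ideal.Quotient.lift_surjective_of_surjective _ _ Φ.rangeRestrict_surjective

end Cone

section Generic

variable {K : Type} [Field K]

theorem exists_tangencyWitnesses [Infinite K] {S : Set (PP K 3)} {W : Grass K 2 3}
    (h : ∃ P Q R : PP K 3, P ≠ Q ∧ P ≠ R ∧ Q ≠ R ∧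
      IsTangentLineAt K S W P ∧ IsTangentLineAt K S W Q ∧ IsTangentLineAt K S W R)
    {T : Set (MvPolynomial (Fin 4) K)} (hT : Ideal.span T = affVanishing K (projCone K S))
    {p : Fin 2 × Fin 4 → K} (hp : frameMem K p W.1)
    (hli : LinearIndependent K ![fun j => p (0, j), fun j => p (1, j)]) :
    ∃ (f : Fin 3 → T) (s t : Fin 3 → K), (∀ k, TangencyWitness S p (f k) (s k) (t k)) ∧
      ∀ i j, i ≠ j → s i * t j - s j * t i ≠ 0 := by
  obtain ⟨P, Q, R, hPQ, hPR, hQR, hP, hQ, hR⟩ := h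
  let x : Fin 3 → PP K 3 := ![P, Q, R]
  have hx : ∀ i j, i ≠ j → x i ≠ x j := by
    intro i j hij
    fin_cases i <;> fin_cases j <;> first | exact absurd rfl hij | simp [x, *, Ne.symm]
  have hxt : ∀ k, IsTangentLineAt K S W (x k) := by
    intro k
    fin_cases k
    exacts [hP, hQ, hR]
  choose f hf s t h0 hmem hw using fun k => (hxt k).exists_witness hT hp hli
  exact ⟨fun k => ⟨f k, hf k⟩, s, t, hw, fun i j hij =>
    minor_ne_zero_of_ne (hx i j hij) (h0 i) (hmem i) (h0 j) (hmem j)⟩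

theorem exists_frame_minor_ne_zero (W : Grass K 2 3) :
    ∃ p : Fin 2 × Fin 4 → K, frameMem K p W.1 ∧
      ∃ i j : Fin 4, p (0, i) * p (1, j) - p (0, j) * p (1, i) ≠ 0 := by
  let b := Module.finBasisOfFinrankEq K W.1 W.2
  refine ⟨fun q => (b q.1 : Fin 4 → K) q.2, fun i => (b i).2,
    exists_minor_ne_zero (v := (b 0 : Fin 4 → K)) (w := b 1) ?_⟩
  have h : ![(b 0 : Fin 4 → K), b 1] = W.1.subtype ∘ b := by
    funext i
    fin_cases i <;> rfl
  rw [h]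
  exact b.linearIndependent.map' W.1.subtype (Submodule.ker_subtype _)

/-- Generic frames of a family of trisecant tangent lines, as an ultrafilter of frames, together
with the parameters of the three tangency points. -/
theorem exists_ultrafilter_tangencyWitness [Infinite K] {S : Set (PP K 3)} {H : Set (Grass K 2 3)}
    (hirr : GrIrred K H)
    (htan : GenerallyOnGr K H (fun L => ∃ P Q R : PP K 3, P ≠ Q ∧ P ≠ R ∧ Q ≠ R ∧
      IsTangentLineAt K S L P ∧ IsTangentLineAt K S L Q ∧ IsTangentLineAt K S L R)) :
    ∃ (l : Ultrafilter (Fin 2 × Fin 4 → K)) (f : Fin 3 → MvPolynomial (Fin 4) K)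
      (s t : Fin 3 → (Fin 2 × Fin 4 → K) → K),
      (∀ᶠ p in (l : Filter (Fin 2 × Fin 4 → K)), p ∈ frameCone K 2 3 H) ∧
      (∀ g, g ∉ affVanishing K (frameCone K 2 3 H) →
        ∀ᶠ p in (l : Filter (Fin 2 × Fin 4 → K)), eval p g ≠ 0) ∧
      (∃ i j : Fin 4, ∀ᶠ p in (l : Filter (Fin 2 × Fin 4 → K)),
        p (0, i) * p (1, j) - p (0, j) * p (1, i) ≠ 0) ∧
      (∀ k, f k ∈ homVanishing K S) ∧
      (∀ᶠ p in (l : Filter (Fin 2 × Fin 4 → K)), ∀ k, TangencyWitness S p (f k) (s k p) (t k p)) ∧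
      ∀ᶠ p in (l : Filter (Fin 2 × Fin 4 → K)),
        ∀ i j, i ≠ j → s i p * t j p - s j p * t i p ≠ 0 := by
  obtain ⟨l, hl, hlI⟩ := exists_ultrafilter_of_isPrime (affVanishing_frameCone_isPrime hirr)
    fun _ => Iff.rfl
  obtain ⟨T, hT⟩ := IsNoetherian.noetherian (affVanishing K (projCone K S))
  obtain ⟨G, ⟨W₁, hW₁, p₁, hp₁, hG₁⟩, hG⟩ := htan
  obtain ⟨p₀, hp₀, i, j, hij⟩ := exists_frame_minor_ne_zero W₁
  have hGl := hlI G fun h => hG₁ (h p₁ ⟨W₁, hW₁, hp₁⟩)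
  have hδl := hlI (X (0, i) * X (1, j) - X (0, j) * X (1, i)) fun h => hij (by
    simpa using h p₀ ⟨W₁, hW₁, hp₀⟩)
  have hδ : ∀ᶠ p in (l : Filter (Fin 2 × Fin 4 → K)),
      p (0, i) * p (1, j) - p (0, j) * p (1, i) ≠ 0 :=
    hδl.mono fun p hp => by simpa using hp
  have hex : ∀ᶠ p in (l : Filter (Fin 2 × Fin 4 → K)),
      ∃ f : Fin 3 → (T : Set (MvPolynomial (Fin 4) K)),
      ∃ st : (Fin 3 → K) × (Fin 3 → K),
        (∀ k, TangencyWitness S p (f k) (st.1 k) (st.2 k)) ∧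
        ∀ i j, i ≠ j → st.1 i * st.2 j - st.1 j * st.2 i ≠ 0 := by
    filter_upwards [hl, hGl, hδ] with p hpH hpG hpδ
    obtain ⟨W, hW, hp⟩ := hpH
    obtain ⟨f, s, t, h⟩ := exists_tangencyWitnesses (hG W hW ⟨p, hp, hpG⟩) hT hp
      (linearIndependent_pair_of_minor_ne_zero hpδ)
    exact ⟨f, (s, t), h⟩
  obtain ⟨f, hf⟩ := Ultrafilter.eventually_exists_iff.1 hex
  obtain ⟨st, hst⟩ := hf.choice
  exact ⟨l, fun k => f k, fun k p => (st p).1 k, fun k p => (st p).2 k, hl, hlI, ⟨i, j, hδ⟩,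
    fun k => mem_affVanishing_projCone_iff.1 (hT ▸ Ideal.subset_span (f k).2),
    hst.mono fun p hp => hp.1, hst.mono fun p hp => hp.2⟩

theorem exists_derivation_ne_zero {E : Type*} [Field E] [Algebra K E] [CharZero K] {z : E}
    (hz : Transcendental K z) : ∃ D : Derivation K E E, D z ≠ 0 := by
  obtain ⟨D, hD⟩ := exists_derivation_of_algebraicIndependent
    ((algebraicIndependent_unique_type_iff (ι := Unit) (x := fun _ => z)).2 hz) fun _ => 1
  exact ⟨D, by rw [hD ()]; exact one_ne_zero⟩

theorem exists_algebraicIndependent_aeval {σ : Type} [Finite σ] {E : Type*} [Field E] [Algebra K E]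
    {I : Ideal (MvPolynomial σ K)} (hI : I ≠ ⊤) {x : σ → E} (hx : ∀ g, aeval x g = 0 ↔ g ∈ I)
    {n : ℕ} (hn : (n : WithBot ℕ∞) ≤ ringKrullDim (MvPolynomial σ K ⧸ I)) :
    ∃ y : Fin n → MvPolynomial σ K, AlgebraicIndependent K fun a => aeval x (y a) := by
  have : Nontrivial (MvPolynomial σ K ⧸ I) := Ideal.Quotient.nontrivial_iff.2 hI
  obtain ⟨y, hy⟩ := exists_algebraicIndependent_of_le_ringKrullDim K _ n hn
  choose z hz using fun a => Ideal.Quotient.mk_surjective (y a)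
  refine ⟨z, ?_⟩
  have hinj : Function.Injective (Ideal.Quotient.liftₐ I (aeval x) fun g hg => (hx g).2 hg) := by
    rw [injective_iff_map_eq_zero]
    intro a ha
    obtain ⟨g, rfl⟩ := Ideal.Quotient.mk_surjective a
    exact Ideal.Quotient.eq_zero_iff_mem.2 ((hx g).1 ha)
  convert hy.map' hinj using 1
  funext a
  rw [Function.comp_apply, ← hz a]
  rfl

theorem germ_ne_zero_iff {X : Type*} {l : Ultrafilter X} {φ : X → K} :
    (φ : Filter.Germ (l : Filter X) K) ≠ 0 ↔ ∀ᶠ p in (l : Filter X), φ p ≠ 0 := by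
  rw [Ultrafilter.eventually_not, Ne, not_iff_not]
  exact Filter.Germ.coe_eq

theorem germ_eq_zero_iff {X : Type*} {l : Ultrafilter X} {φ : X → K} :
    (φ : Filter.Germ (l : Filter X) K) = 0 ↔ ∀ᶠ p in (l : Filter X), φ p = 0 :=
  Filter.Germ.coe_eq

theorem exists_plane [IsAlgClosed K] [CharZero K] {S : Set (PP K 3)} {H : Set (Grass K 2 3)}
    (hirr : GrIrred K H) (hHdim : GrDimGE K H 2)
    (htan : GenerallyOnGr K H (fun L => ∃ P Q R : PP K 3, P ≠ Q ∧ P ≠ R ∧ Q ≠ R ∧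
      IsTangentLineAt K S L P ∧ IsTangentLineAt K S L Q ∧ IsTangentLineAt K S L R)) :
    ∃ μ : Fin 4 → K, μ ≠ 0 ∧ (∀ W ∈ H, ∀ z ∈ W.1, μ ⬝ᵥ z = 0) ∧
      ∀ M : Submodule K (Fin 4 → K), (∀ z, z ∈ M ↔ μ ⬝ᵥ z = 0) →
        ProjDimGE K {P | P ∈ S ∧ P ∈ projLinear K M ∧
          projTangentAt K S P ⊆ projLinear K M} 1 := by
  obtain ⟨l, f, s, t, hl, hlI, ⟨i₀, j₀, hδ⟩, hfS, hw, hst⟩ :=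
    exists_ultrafilter_tangencyWitness hirr htan
  let E := Filter.Germ (l : Filter (Fin 2 × Fin 4 → K)) K
  let x : Fin 2 × Fin 4 → E := fun q => ((fun p => p q : (Fin 2 × Fin 4 → K) → K) : E)
  let P : Fin 3 → Fin 4 → E := fun k i =>
    ((fun p => framePoint p (s k p) (t k p) i : (Fin 2 × Fin 4 → K) → K) : E)
  let m : Fin 3 → Fin 4 → E := fun k i =>
    ((fun p => gradVec K (f k) (framePoint p (s k p) (t k p)) i : (Fin 2 × Fin 4 → K) → K) : E)
  have hx : ∀ g, aeval x g = 0 ↔ g ∈ affVanishing K (frameCone K 2 3 H) := fun g => by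
    rw [germ_aeval, germ_eq_zero_iff]
    refine ⟨fun h => by_contra fun hg => ?_, fun h => hl.mono fun p hp => h p hp⟩
    obtain ⟨p, hp, hp'⟩ := (h.and (hlI g hg)).exists
    exact hp' hp
  obtain ⟨y, hy⟩ := exists_algebraicIndependent_aeval
    (affVanishing_frameCone_isPrime hirr).ne_top hx hHdim
  have hm : ∀ k i, m k i = aeval (P k) (pderiv i (f k)) := fun k i => (germ_aeval l _ _).symm
  have hP : ∀ k, P k = (s k : E) • (fun j => x (0, j)) + (t k : E) • fun j => x (1, j) :=
    fun k => rfl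
  have hfP : ∀ k, aeval (P k) (f k) = 0 := fun k => by
    rw [germ_aeval, germ_eq_zero_iff]
    filter_upwards [hw] with p hp
    obtain ⟨-, -, -, z, hz, hmem, -⟩ := hp k
    exact hfS k z hz _ hmem
  have hm0 : ∀ k, m k ≠ 0 := fun k h => by
    have h0 : ∀ᶠ p in (l : Filter (Fin 2 × Fin 4 → K)), ∀ i,
        gradVec K (f k) (framePoint p (s k p) (t k p)) i = 0 :=
      Filter.eventually_all.2 fun i => germ_eq_zero_iff.1 (congr_fun h i)
    obtain ⟨p, hp, hp'⟩ := (h0.and hw).exists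
    exact (hp' k).1 (funext hp)
  obtain ⟨⟨μ, c, hμ, hc, hμc⟩, a, b, hb, hab⟩ :=
    (atMostTwoRelations_of_algebraicIndependent x y hy).exists_constant_plane
      (fun z hz => exists_derivation_ne_zero hz)
      (linearIndependent_pair_of_minor_ne_zero (i := i₀) (j := j₀) (germ_ne_zero_iff.2 hδ))
      (s := fun k => (s k : E)) (t := fun k => (t k : E))
      (fun i j hij => germ_ne_zero_iff.2 (hst.mono fun p hp => hp i j hij)) hm0
      (fun k => (germ_dotProduct l _ _).trans
        (germ_eq_zero_iff.2 (hw.mono fun p hp => (hp k).2.1)))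
      (fun k => (germ_dotProduct l _ _).trans
        (germ_eq_zero_iff.2 (hw.mono fun p hp => (hp k).2.2.1)))
      (fun k D => by
        rw [← hP]
        have := derivation_aeval D (P k) (f k)
        rw [hfP, map_zero] at this
        rw [this]
        exact Finset.sum_congr rfl fun i _ => by rw [hm])
  rw [← hP] at hb hab
  obtain ⟨c, rfl⟩ : ∃ d : (Fin 2 × Fin 4 → K) → K, (d : E) = c :=
    Filter.Germ.inductionOn c fun d => ⟨d, rfl⟩
  have hgrad : ∀ᶠ p in (l : Filter (Fin 2 × Fin 4 → K)), c p ≠ 0 ∧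
      gradVec K (f 0) (framePoint p (s 0 p) (t 0 p)) = c p • μ := by
    refine (germ_ne_zero_iff.1 hc).and ?_
    have : ∀ᶠ p in (l : Filter (Fin 2 × Fin 4 → K)), ∀ i,
        gradVec K (f 0) (framePoint p (s 0 p) (t 0 p)) i = c p * μ i :=
      Filter.eventually_all.2 fun i => Filter.Germ.coe_eq.1 (congr_fun hμc i)
    exact this.mono fun p hp => funext hp
  have hμz : ∀ᶠ p in (l : Filter (Fin 2 × Fin 4 → K)), ∀ z,
      gradVec K (f 0) (framePoint p (s 0 p) (t 0 p)) ⬝ᵥ z = 0 → μ ⬝ᵥ z = 0 := by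
    filter_upwards [hgrad] with p hp z hz
    rw [hp.2, smul_dotProduct, smul_eq_mul] at hz
    exact (mul_eq_zero.1 hz).resolve_left hp.1
  have hμ₀ : ∀ᶠ p in (l : Filter (Fin 2 × Fin 4 → K)), (μ ⬝ᵥ fun j => p (0, j)) = 0 := by
    filter_upwards [hμz, hw] with p hp hwp using hp _ (hwp 0).2.1
  have hμ₁ : ∀ᶠ p in (l : Filter (Fin 2 × Fin 4 → K)), (μ ⬝ᵥ fun j => p (1, j)) = 0 := by
    filter_upwards [hμz, hw] with p hp hwp using hp _ (hwp 0).2.2.1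
  refine ⟨μ, hμ, fun W hW z hz => ?_, fun M hM => ?_⟩
  · have hmem : ∑ j, C (μ j) * X (0, j) ∈ affVanishing K (frameCone K 2 3 H) := by
      rw [← hx, germ_aeval, germ_eq_zero_iff]
      refine hμ₀.mono fun p hp => ?_
      simpa [dotProduct] using hp
    simpa [dotProduct] using hmem (fun q => z q.2) ⟨W, hW, fun _ => hz⟩
  · refine two_le_ringKrullDim_of_cone (E := E) (u := P 0) (fun g hg κ => ?_) hb hab
    have hκ : (fun i => algebraMap K E κ * P 0 i) = fun i =>
        ((fun p => κ * framePoint p (s 0 p) (t 0 p) i : (Fin 2 × Fin 4 → K) → K) : E) := rfl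
    rw [hκ, germ_aeval, germ_eq_zero_iff]
    filter_upwards [hμz, hw, hμ₀, hμ₁, germ_ne_zero_iff.1 hb] with p hp hwp h₀ h₁ hne
    obtain ⟨-, -, -, Q, hQ, hmem, hQt⟩ := hwp 0
    have hne' : framePoint p (s 0 p) (t 0 p) ≠ 0 := fun h => hne (congr_fun h b)
    refine hg _ ⟨Q, ⟨hQ, ?_, fun y hy z hz => (hM z).2 (hp z (hQt y hy z hz))⟩,
      Q.submodule.smul_mem κ hmem⟩
    change Q.submodule ≤ M
    rw [submodule_eq_span hne' hmem, Submodule.span_singleton_le_iff_mem, hM, framePoint,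
      dotProduct_add, dotProduct_smul, dotProduct_smul, h₀, h₁, smul_zero, smul_zero, add_zero]

theorem finrank_ker_dotProduct {μ : Fin 4 → K} (hμ : μ ≠ 0) :
    Module.finrank K (LinearMap.ker (dotProductBilin K K μ)) = 3 := by
  have h : dotProductBilin K K μ ≠ 0 := fun h =>
    hμ (dotProduct_eq_zero μ fun z => LinearMap.congr_fun h z)
  have := Module.Dual.finrank_ker_add_one_of_ne_zero h
  rw [Module.finrank_fin_fun] at this
  omega

end Generic

/-- if `S ⊆ ℙ³` is a (reduced) surface and `H ⊆ G(1,3)` is an irreducible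
subvariety of dimension at least `2` whose general point is a line tangent to `S` at more
than two distinct (smooth) points, then `dim H = 2` and `H` consists of the lines contained
in a fixed plane `M` which is tangent to `S` along a curve. -/
theorem trisecant_tangent_lines_lemma
    (K : Type) [Field K] [IsAlgClosed K] [CharZero K]
    (S : Set (PP K 3)) (hScl : ProjClosed K S) (hSdim : HasProjDim K S 2)
    (H : Set (Grass K 2 3)) (hirr : GrIrred K H) (hHdim : GrDimGE K H 2)
    (htan : GenerallyOnGr K H (fun L => ∃ P Q R : PP K 3, P ≠ Q ∧ P ≠ R ∧ Q ≠ R ∧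
      IsTangentLineAt K S L P ∧ IsTangentLineAt K S L Q ∧ IsTangentLineAt K S L R)) :
    HasGrDim K H 2 ∧ ∃ M : Submodule K (Fin 4 → K), Module.finrank K M = 3 ∧
      grClosure K H = {W : Grass K 2 3 | W.1 ≤ M} ∧
      ProjDimGE K {P | P ∈ S ∧ P ∈ projLinear K M ∧
        projTangentAt K S P ⊆ projLinear K M} 1 := by
  obtain ⟨μ, hμ, hH, hcurve⟩ := exists_plane hirr hHdim htan
  have hM : ∀ z, z ∈ LinearMap.ker (dotProductBilin K K μ) ↔ μ ⬝ᵥ z = 0 := fun _ => Iff.rfl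
  have hM3 := finrank_ker_dotProduct hμ
  have hHM : ∀ W ∈ H, W.1 ≤ LinearMap.ker (dotProductBilin K K μ) := hH
  exact ⟨hasGrDim_two_of_le hHdim hM3 hHM, _, hM3, grClosure_eq_of_le hHdim hM hM3 hHM,
    hcurve _ hM⟩

end PaperLines
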